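/- arXiv:1908.04096 — 2 statements merged into one kernel-verified Lean document; each statement's English description precedes it below -/
import Mathlib

section
/- Let D be a k-critical digraph, let D_L be the subdigraph of D induced by the vertices v with d⁺_D(v) = d⁻_D(v) = k − 1, and let B be a block of D_L with at least 3 vertices. Then every vertex v of B satisfies d⁺_B(v) = d⁻_B(v); in particular, B is Eulerian. -/
/-- A finite digraph on the vertex type `ℕ`: a finite vertex set together with a
finite set of arcs (ordered pairs of vertices), loopless, without parallel arcs
(but opposite arcs between two vertices are allowed). -/
structure Digr where
  verts : Finset ℕ
  arcs : Finset (ℕ × ℕ)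
  arcs_sub : ∀ a ∈ arcs, a.1 ∈ verts ∧ a.2 ∈ verts
  no_loops : ∀ a ∈ arcs, a.1 ≠ a.2

namespace Digr

/-- `D'` is a subdigraph of `D`. -/
def Sub (D' D : Digr) : Prop := D'.verts ⊆ D.verts ∧ D'.arcs ⊆ D.arcs

/-- An acyclic coloring of `D` with `n` colors: no directed cycle is monochromatic.
A monochromatic directed cycle through `v` is exactly a nontrivial closed walk from `v`
to `v` along arcs whose endpoints always get equal colors. -/
def GoodColoring (D : Digr) (n : ℕ) (φ : ℕ → Fin n) : Prop :=
  ∀ v, ¬ Relation.TransGen (fun x y => (x, y) ∈ D.arcs ∧ φ x = φ y) v v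

/-- `D` admits an acyclic coloring with `n` colors. -/
def Colorable (D : Digr) (n : ℕ) : Prop := ∃ φ : ℕ → Fin n, D.GoodColoring n φ

/-- The dichromatic number of `D`. -/
noncomputable def dichrom (D : Digr) : ℕ := sInf {n | D.Colorable n}

/-- `D` is `k`-critical: its dichromatic number is `k` and every proper subdigraph
has smaller dichromatic number. -/
def Critical (k : ℕ) (D : Digr) : Prop :=
  D.dichrom = k ∧ ∀ D' : Digr, D'.Sub D → D' ≠ D → D'.dichrom < k

/-- Deletion of a vertex. -/
def delete (D : Digr) (v : ℕ) : Digr where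
  verts := D.verts.erase v
  arcs := D.arcs.filter (fun a => a.1 ≠ v ∧ a.2 ≠ v)
  arcs_sub := by
    intro a ha
    rw [Finset.mem_filter] at ha
    obtain ⟨ha, h1, h2⟩ := ha
    have h := D.arcs_sub a ha
    exact ⟨Finset.mem_erase.mpr ⟨h1, h.1⟩, Finset.mem_erase.mpr ⟨h2, h.2⟩⟩
  no_loops := fun a ha => D.no_loops a (Finset.mem_filter.mp ha).1

/-- The subdigraph of `D` induced by a set `S` of vertices. -/
def induce (D : Digr) (S : Finset ℕ) : Digr where
  verts := D.verts ∩ S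
  arcs := D.arcs.filter (fun a => a.1 ∈ S ∧ a.2 ∈ S)
  arcs_sub := by
    intro a ha
    rw [Finset.mem_filter] at ha
    obtain ⟨ha, h1, h2⟩ := ha
    have h := D.arcs_sub a ha
    exact ⟨Finset.mem_inter.mpr ⟨h.1, h1⟩, Finset.mem_inter.mpr ⟨h.2, h2⟩⟩
  no_loops := fun a ha => D.no_loops a (Finset.mem_filter.mp ha).1

/-- Out-neighborhood of `v` in `D`. -/
def outNbrs (D : Digr) (v : ℕ) : Finset ℕ := D.verts.filter (fun y => (v, y) ∈ D.arcs)

/-- In-neighborhood of `v` in `D`. -/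
def inNbrs (D : Digr) (v : ℕ) : Finset ℕ := D.verts.filter (fun x => (x, v) ∈ D.arcs)

/-- Out-degree. -/
def outDeg (D : Digr) (v : ℕ) : ℕ := (D.outNbrs v).card

/-- In-degree. -/
def inDeg (D : Digr) (v : ℕ) : ℕ := (D.inNbrs v).card

/-- `D` is (weakly) connected, i.e. its underlying graph is connected. -/
def Conn (D : Digr) : Prop :=
  ∀ x ∈ D.verts, ∀ y ∈ D.verts,
    Relation.ReflTransGen (fun a b => (a, b) ∈ D.arcs ∨ (b, a) ∈ D.arcs) x y

/-- `D` is strongly connected. -/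
def StronglyConn (D : Digr) : Prop :=
  ∀ x ∈ D.verts, ∀ y ∈ D.verts,
    Relation.ReflTransGen (fun a b => (a, b) ∈ D.arcs) x y

/-- `H` has no separating vertex. -/
def NoSepVertex (H : Digr) : Prop := ∀ v ∈ H.verts, (H.delete v).Conn

/-- `B` is a block of `D`: a maximal connected subdigraph of `D` without a
separating vertex. -/
def IsBlock (B D : Digr) : Prop :=
  B.Sub D ∧ B.Conn ∧ B.NoSepVertex ∧
    ∀ B' : Digr, B'.Sub D → B'.Conn → B'.NoSepVertex → B.Sub B' → B' = B

/-- `B` is a directed cycle (of length ≥ 2). -/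
def IsDirCycle (B : Digr) : Prop :=
  ∃ (n : ℕ) (f : ℕ → ℕ), 2 ≤ n ∧ Set.InjOn f ↑(Finset.range n) ∧
    B.verts = (Finset.range n).image f ∧
    B.arcs = (Finset.range n).image (fun i => (f i, f ((i + 1) % n)))

/-- `B` is a bidirected cycle of length `n`. -/
def IsBidirCycle (B : Digr) (n : ℕ) : Prop :=
  ∃ f : ℕ → ℕ, Set.InjOn f ↑(Finset.range n) ∧
    B.verts = (Finset.range n).image f ∧
    B.arcs = (Finset.range n).image (fun i => (f i, f ((i + 1) % n))) ∪
      (Finset.range n).image (fun i => (f ((i + 1) % n), f i))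

/-- `B` is a bidirected complete graph: every ordered pair of distinct vertices is an arc. -/
def IsBidirComplete (B : Digr) : Prop :=
  B.arcs = (B.verts ×ˢ B.verts).filter (fun a => a.1 ≠ a.2)

/-- `D` contains a bidirected complete graph on `k` vertices as a subdigraph. -/
def ContainsK (k : ℕ) (D : Digr) : Prop :=
  ∃ S : Finset ℕ, S ⊆ D.verts ∧ S.card = k ∧
    ∀ x ∈ S, ∀ y ∈ S, x ≠ y → (x, y) ∈ D.arcs

/-- `D` is the Dirac join of the disjoint digraphs `D1` and `D2`: their union
together with all arcs in both directions between them. -/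
def IsDiracJoin (D D1 D2 : Digr) : Prop :=
  Disjoint D1.verts D2.verts ∧
  D.verts = D1.verts ∪ D2.verts ∧
  D.arcs = D1.arcs ∪ D2.arcs ∪ D1.verts ×ˢ D2.verts ∪ D2.verts ×ˢ D1.verts

/-- `D` is the directed Hajós join `(D1, v1, u1) ▽ (D2, v2, u2)` of the disjoint
digraphs `D1` and `D2`: delete the arcs `u1v1` and `v2u2`, identify `v1` and `v2`
(the merged vertex is represented by `v1`), and add the arc `u1u2`. -/
def IsHajosJoin (D D1 D2 : Digr) (u1 v1 v2 u2 : ℕ) : Prop :=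
  Disjoint D1.verts D2.verts ∧
  (u1, v1) ∈ D1.arcs ∧ (v2, u2) ∈ D2.arcs ∧
  D.verts = D1.verts ∪ D2.verts.erase v2 ∧
  D.arcs = D1.arcs.erase (u1, v1) ∪
      (D2.arcs.erase (v2, u2)).image
        (Prod.map (fun x => if x = v2 then v1 else x) (fun x => if x = v2 then v1 else x)) ∪
      {(u1, u2)}

/-- `D` is the bidirected Hajós join `(D1, v1, u1) ▽̄ (D2, v2, u2)` of the disjoint
digraphs `D1` and `D2`: delete both arcs of the digon between `u1` and `v1` and both
arcs of the digon between `u2` and `v2`, identify `v1` and `v2` (the merged vertex is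
represented by `v1`), and add both arcs `u1u2` and `u2u1`. -/
def IsBidirHajosJoin (D D1 D2 : Digr) (u1 v1 v2 u2 : ℕ) : Prop :=
  Disjoint D1.verts D2.verts ∧
  (u1, v1) ∈ D1.arcs ∧ (v1, u1) ∈ D1.arcs ∧
  (u2, v2) ∈ D2.arcs ∧ (v2, u2) ∈ D2.arcs ∧
  D.verts = D1.verts ∪ D2.verts.erase v2 ∧
  D.arcs = ((D1.arcs.erase (u1, v1)).erase (v1, u1)) ∪
      (((D2.arcs.erase (v2, u2)).erase (u2, v2)).image
        (Prod.map (fun x => if x = v2 then v1 else x) (fun x => if x = v2 then v1 else x))) ∪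
      {(u1, u2), (u2, u1)}

/-- `D'` is obtained from `D` by identifying the non-empty independent set `I`
with the (new) vertex `v`. -/
def IsIdent (D' D : Digr) (I : Finset ℕ) (v : ℕ) : Prop :=
  I.Nonempty ∧ I ⊆ D.verts ∧
  (∀ x ∈ I, ∀ y ∈ I, (x, y) ∉ D.arcs) ∧
  (v ∈ I ∨ v ∉ D.verts) ∧
  D'.verts = (D.verts \ I) ∪ {v} ∧
  D'.arcs = D.arcs.filter (fun a => a.1 ∉ I ∧ a.2 ∉ I) ∪
      (D.arcs.filter (fun a => a.1 ∈ I ∧ a.2 ∉ I)).image (fun a => (v, a.2)) ∪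
      (D.arcs.filter (fun a => a.1 ∉ I ∧ a.2 ∈ I)).image (fun a => (a.1, v))

/-- Isomorphism of digraphs. -/
def Iso (D D' : Digr) : Prop :=
  ∃ f : ℕ → ℕ, Set.BijOn f ↑D.verts ↑D'.verts ∧
    ∀ x ∈ D.verts, ∀ y ∈ D.verts, ((x, y) ∈ D.arcs ↔ (f x, f y) ∈ D'.arcs)

/-- The Hajós-`k`-constructible digraphs: the smallest family of digraphs (closed
under isomorphism) containing the bidirected complete graph on `k` vertices and
closed under directed Hajós joins and identification of independent sets. -/
inductive HajosConstr (k : ℕ) : Digr → Prop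
  | base (D : Digr) : D.verts.card = k → D.IsBidirComplete → HajosConstr k D
  | join (D D1 D2 : Digr) (u1 v1 v2 u2 : ℕ) :
      HajosConstr k D1 → HajosConstr k D2 →
      IsHajosJoin D D1 D2 u1 v1 v2 u2 → HajosConstr k D
  | ident (D' D : Digr) (I : Finset ℕ) (v : ℕ) :
      HajosConstr k D → IsIdent D' D I v → HajosConstr k D'
  | iso (D D' : Digr) : HajosConstr k D → Iso D D' → HajosConstr k D'

/-- `D` is a directed Ore join of the disjoint digraphs `D1` and `D2`: a directed
Hajós join followed by identifying each `w` in a set `A1 ⊆ V(D1 - v1)` with `ι w`,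
where `ι` is a bijection from `A1` onto a subset of `V(D2 - v2)` with `ι u1 ≠ u2`. -/
def IsOreJoin (D D1 D2 : Digr) (u1 v1 v2 u2 : ℕ) : Prop :=
  ∃ (H : Digr) (A1 : Finset ℕ) (ι : ℕ → ℕ),
    IsHajosJoin H D1 D2 u1 v1 v2 u2 ∧
    A1 ⊆ D1.verts.erase v1 ∧
    A1.image ι ⊆ D2.verts.erase v2 ∧
    Set.InjOn ι ↑A1 ∧
    (u1 ∈ A1 → ι u1 ≠ u2) ∧
    D.verts = H.verts.image (fun x => if x ∈ A1 then ι x else x) ∧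
    D.arcs = H.arcs.image
      (Prod.map (fun x => if x ∈ A1 then ι x else x) (fun x => if x ∈ A1 then ι x else x))

/-- `D` is a bidirected Ore join of the disjoint digraphs `D1` and `D2`: a bidirected
Hajós join followed by the same kind of identification as in the directed Ore join. -/
def IsBidirOreJoin (D D1 D2 : Digr) (u1 v1 v2 u2 : ℕ) : Prop :=
  ∃ (H : Digr) (A1 : Finset ℕ) (ι : ℕ → ℕ),
    IsBidirHajosJoin H D1 D2 u1 v1 v2 u2 ∧
    A1 ⊆ D1.verts.erase v1 ∧
    A1.image ι ⊆ D2.verts.erase v2 ∧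
    Set.InjOn ι ↑A1 ∧
    (u1 ∈ A1 → ι u1 ≠ u2) ∧
    D.verts = H.verts.image (fun x => if x ∈ A1 then ι x else x) ∧
    D.arcs = H.arcs.image
      (Prod.map (fun x => if x ∈ A1 then ι x else x) (fun x => if x ∈ A1 then ι x else x))

/-- The Ore-`k`-constructible digraphs: the smallest family of digraphs (closed under
isomorphism) containing the bidirected complete graph on `k` vertices and closed
under directed and bidirected Ore joins. -/
inductive OreConstr (k : ℕ) : Digr → Prop
  | base (D : Digr) : D.verts.card = k → D.IsBidirComplete → OreConstr k D
  | dirJoin (D D1 D2 : Digr) (u1 v1 v2 u2 : ℕ) :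
      OreConstr k D1 → OreConstr k D2 →
      IsOreJoin D D1 D2 u1 v1 v2 u2 → OreConstr k D
  | bidirJoin (D D1 D2 : Digr) (u1 v1 v2 u2 : ℕ) :
      OreConstr k D1 → OreConstr k D2 →
      IsBidirOreJoin D D1 D2 u1 v1 v2 u2 → OreConstr k D
  | iso (D D' : Digr) : OreConstr k D → Iso D D' → OreConstr k D'

/-- The set of low vertices of `D` (for the parameter `k`): the vertices with
out-degree and in-degree both equal to `k - 1`. -/
def lowVerts (D : Digr) (k : ℕ) : Finset ℕ :=
  D.verts.filter (fun v => D.outDeg v = k - 1 ∧ D.inDeg v = k - 1)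

end Digr

namespace Gallai

/-- `φ` is an acyclic coloring of the digraph with arc relation `A` minus the vertex `v`. -/
def Good {n : ℕ} (A : ℕ → ℕ → Prop) (v : ℕ) (φ : ℕ → Fin n) : Prop :=
  ∀ x, ¬ Relation.TransGen (fun x y => (A x y ∧ x ≠ v ∧ y ≠ v) ∧ φ x = φ y) x x

lemma acyc_of_no_out (R R' : ℕ → ℕ → Prop) (v : ℕ) (hv : ∀ y, ¬ R' v y)
    (h : ∀ a b, R' a b → a ≠ v → b ≠ v → R a b)
    (hR : ∀ x, ¬ Relation.TransGen R x x) : ∀ x, ¬ Relation.TransGen R' x x := by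
  have key : ∀ a b, Relation.TransGen R' a b → b ≠ v → Relation.TransGen R a b := by
    intro a b hab
    induction hab with
    | single hb =>
      intro hbv
      refine Relation.TransGen.single (h _ _ hb ?_ hbv)
      rintro rfl
      exact hv _ hb
    | @tail b c _ hb ih =>
      intro hcv
      have hne : b ≠ v := by
        intro hh
        rw [hh] at hb
        exact hv _ hb
      exact (ih hne).tail (h _ _ hb hne hcv)
  intro x hx
  by_cases hxv : x = v
  · subst hxv
    obtain ⟨y, hy, -⟩ := Relation.TransGen.head'_iff.1 hx
    exact hv _ hy
  · exact hR x (key x x hx hxv)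

lemma acyc_of_no_in (R R' : ℕ → ℕ → Prop) (v : ℕ) (hv : ∀ y, ¬ R' y v)
    (h : ∀ a b, R' a b → a ≠ v → b ≠ v → R a b)
    (hR : ∀ x, ¬ Relation.TransGen R x x) : ∀ x, ¬ Relation.TransGen R' x x := by
  intro x hx
  refine acyc_of_no_out (Function.swap R) (Function.swap R') v hv
    (fun a b hab ha hb => h b a hab hb ha) ?_ x (Relation.transGen_swap.2 hx)
  intro y hy
  exact hR y (Relation.transGen_swap.1 hy)

lemma Good.swap {n : ℕ} {A : ℕ → ℕ → Prop} {v : ℕ} {φ : ℕ → Fin n} (h : Good A v φ) :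
    Good (fun x y => A y x) v φ := by
  intro x hx
  refine h x ?_
  rw [← Relation.transGen_swap]
  refine Relation.TransGen.mono ?_ _ _ hx
  rintro a b ⟨⟨h1, h2, h3⟩, h4⟩
  exact ⟨⟨h1, h3, h2⟩, h4.symm⟩

/-- Shifting the hole from `v` to a neighbour `u`. -/
lemma shift {n : ℕ} {A : ℕ → ℕ → Prop} {v u : ℕ} {φ : ℕ → Fin n}
    (hA : ∀ x, ¬ A x x)
    (h1 : ∀ y z, A v y → A v z → φ y = φ z → y = z)
    (h2 : ∀ y z, A y v → A z v → φ y = φ z → y = z)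
    (hadj : A v u ∨ A u v) (h : Good A v φ) :
    Good A u (Function.update φ v (φ u)) := by
  have hmono : ∀ a b, ((A a b ∧ a ≠ u ∧ b ≠ u) ∧
      Function.update φ v (φ u) a = Function.update φ v (φ u) b) → a ≠ v → b ≠ v →
      ((A a b ∧ a ≠ v ∧ b ≠ v) ∧ φ a = φ b) := by
    rintro a b ⟨⟨ha, -, -⟩, hb⟩ hav hbv
    rw [Function.update_of_ne hav, Function.update_of_ne hbv] at hb
    exact ⟨⟨ha, hav, hbv⟩, hb⟩
  rcases hadj with hadj | hadj
  · refine acyc_of_no_out _ _ v ?_ hmono h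
    rintro y ⟨⟨ha, -, hyu⟩, hb⟩
    have hyv : y ≠ v := by rintro rfl; exact hA _ ha
    rw [Function.update_self, Function.update_of_ne hyv] at hb
    exact hyu (h1 _ _ ha hadj hb.symm)
  · refine acyc_of_no_in _ _ v ?_ hmono h
    rintro y ⟨⟨ha, hyu, -⟩, hb⟩
    have hyv : y ≠ v := by rintro rfl; exact hA _ ha
    rw [Function.update_self, Function.update_of_ne hyv] at hb
    exact hyu (h2 _ _ ha hadj hb)

/-- In every coloring of `D - v`, the out-neighbours of `v` carry every color exactly once. -/
def Low (n : ℕ) (A : ℕ → ℕ → Prop) (v : ℕ) : Prop :=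
  ∀ φ : ℕ → Fin n, Good A v φ →
    (∀ c, ∃ y, A v y ∧ φ y = c) ∧ (∀ y z, A v y → A v z → φ y = φ z → y = z)

/-- The colorings obtained by moving the hole along `Y`. -/
def Phi {n : ℕ} (φ : ℕ → Fin n) (Y : ℕ → ℕ) : ℕ → ℕ → Fin n
  | 0 => φ
  | t + 1 => Function.update (Phi φ Y t) (Y t) (Phi φ Y t (Y (t + 1)))

section cyc
variable {n : ℕ} {A : ℕ → ℕ → Prop} {φ : ℕ → Fin n} {Y : ℕ → ℕ} {m : ℕ}

lemma good_Phi (hA : ∀ x, ¬ A x x) (hL : ∀ t, Low n A (Y t))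
    (hL' : ∀ t, Low n (fun x y => A y x) (Y t))
    (hadj : ∀ t, A (Y t) (Y (t + 1)) ∨ A (Y (t + 1)) (Y t))
    (hφ : Good A (Y 0) φ) (t : ℕ) : Good A (Y t) (Phi φ Y t) := by
  induction t with
  | zero => exact hφ
  | succ t ih =>
    exact shift hA (hL t _ ih).2 (hL' t _ ih.swap).2 (hadj t) ih

lemma Phi_off {z : ℕ} (hz : ∀ t, z ≠ Y t) (t : ℕ) : Phi φ Y t z = φ z := by
  induction t with
  | zero => rfl
  | succ t ih => rw [Phi, Function.update_of_ne (hz t), ih]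

lemma Phi_persist (hinj : ∀ t j, 1 ≤ j → j ≤ m → Y (t + j) ≠ Y t) (t j : ℕ) (hj : j + 1 ≤ m) :
    Phi φ Y (t + (j + 1)) (Y t) = Phi φ Y t (Y (t + 1)) := by
  induction j with
  | zero => simp [Phi]
  | succ j ih =>
    rw [← ih (by omega), ← add_assoc t (j + 1) 1, Phi, Function.update_of_ne]
    exact (hinj t (j + 1) (by omega) (by omega)).symm

lemma mem_cycle (hper : ∀ t, Y (t + (m + 1)) = Y t) (s t : ℕ) : ∃ j ≤ m, Y s = Y (t + j) := by
  have hp : Function.Periodic Y (m + 1) := hper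
  refine ⟨(s + t * m) % (m + 1), Nat.lt_succ_iff.1 (Nat.mod_lt _ (Nat.succ_pos m)), ?_⟩
  have h1 : Y (s + t * (m + 1)) = Y s := by
    have := hp.nat_mul t s
    simpa using this
  have h2 : s + t * (m + 1) = t + (s + t * m) := by ring
  rw [← h1, h2]
  have h3 := Nat.mod_add_div (s + t * m) (m + 1)
  conv_lhs => rw [← h3]
  have := hp.nat_mul ((s + t * m) / (m + 1)) (t + (s + t * m) % (m + 1))
  rw [← this]
  congr 1
  push_cast
  ring

/-- The colors on the out-neighbours of `Y t` on the cycle. -/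
lemma out_iff (hA : ∀ x, ¬ A x x) (hm : 2 ≤ m) (hL : ∀ t, Low n A (Y t))
    (hper : ∀ t, Y (t + (m + 1)) = Y t)
    (hchord : ∀ t j, 2 ≤ j → j < m → ¬ A (Y t) (Y (t + j)))
    (hgood : ∀ t, Good A (Y t) (Phi φ Y t)) (t : ℕ) (c : Fin n) :
    (A (Y t) (Y (t + 1)) ∧ Phi φ Y t (Y (t + 1)) = c ∨
      A (Y t) (Y (t + m)) ∧ Phi φ Y t (Y (t + m)) = c) ↔
    ¬ ∃ z, (∀ s, z ≠ Y s) ∧ A (Y t) z ∧ φ z = c := by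
  obtain ⟨hs, hi⟩ := hL t _ (hgood t)
  constructor
  · rintro h ⟨z, hz, hAz, hc⟩
    have hz' := Phi_off (φ := φ) hz t
    rcases h with ⟨h1, h2⟩ | ⟨h1, h2⟩
    · exact hz _ (hi _ _ hAz h1 (by rw [hz', hc, h2]))
    · exact hz _ (hi _ _ hAz h1 (by rw [hz', hc, h2]))
  · intro h
    obtain ⟨y, hy, hyc⟩ := hs c
    by_cases hoff : ∀ s, y ≠ Y s
    · exact absurd ⟨y, hoff, hy, by rw [← Phi_off (φ := φ) hoff t, hyc]⟩ h
    · push Not at hoff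
      obtain ⟨s, rfl⟩ := hoff
      obtain ⟨j, hj, hjs⟩ := mem_cycle hper s t
      rw [hjs] at hy hyc
      rcases Nat.lt_or_ge j 2 with h2 | h2
      · interval_cases j
        · exact absurd hy (hA _)
        · exact Or.inl ⟨hy, hyc⟩
      · rcases Nat.lt_or_ge j m with h3 | h3
        · exact absurd hy (hchord t j h2 h3)
        · obtain rfl : j = m := by omega
          exact Or.inr ⟨hy, hyc⟩

/-- Main cycle lemma. -/
lemma cycle_lemma (hA : ∀ x, ¬ A x x) (hm : 2 ≤ m) (hL : ∀ t, Low n A (Y t))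
    (hL' : ∀ t, Low n (fun x y => A y x) (Y t))
    (hper : ∀ t, Y (t + (m + 1)) = Y t)
    (hinj : ∀ t j, 1 ≤ j → j ≤ m → Y (t + j) ≠ Y t)
    (hadj : ∀ t, A (Y t) (Y (t + 1)) ∨ A (Y (t + 1)) (Y t))
    (hchord : ∀ t j, 2 ≤ j → j < m → ¬ A (Y t) (Y (t + j)))
    (hchord' : ∀ t j, 2 ≤ j → j < m → ¬ A (Y (t + j)) (Y t))
    (hφ : Good A (Y 0) φ) (w : ℕ) (h0 : A (Y 0) (Y 1)) (hw : A w (Y 0))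
    (hc : φ w = φ (Y 1)) (hoff : ∀ s, w ≠ Y s) : False := by
  have hgood := good_Phi hA hL hL' hadj hφ
  have hout := out_iff (φ := φ) hA hm hL hper hchord hgood
  have hin := out_iff (A := fun x y => A y x) (φ := φ) hA hm hL' hper hchord'
    (fun t => (hgood t).swap)
  obtain ⟨f, hf⟩ : ∃ f : ℕ → Fin n, ∀ t, Phi φ Y t (Y (t + 1)) = f t := ⟨_, fun _ => rfl⟩
  have hback : ∀ t, Phi φ Y (t + 1) (Y (t + 1 + m)) = f t := by
    intro t
    rw [show t + 1 + m = t + (m + 1) by ring, hper, Phi, Function.update_self, hf]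
  have hfper : ∀ t, f (t + m) = f t := by
    intro t
    have := Phi_persist (φ := φ) hinj t (m - 1) (by omega)
    rw [show m - 1 + 1 = m by omega, hf] at this
    rw [← hf, add_assoc, hper, this]
  have hY1 : ∀ t, Y (t + 1 + m) = Y t := by
    intro t
    rw [show t + 1 + m = t + (m + 1) by ring, hper]
  have hYm : ∀ t, Y (t + (m + 1) + 1) = Y (t + 1) := by
    intro t
    rw [show t + (m + 1) + 1 = t + 1 + (m + 1) by ring, hper]
  have hYm' : ∀ t, Y (t + (m + 1) + m) = Y (t + m) := by
    intro t
    rw [show t + (m + 1) + m = t + m + (m + 1) by ring, hper]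
  have hfm : ∀ t, f (t + (m + 1)) = f (t + 1) := by
    intro t
    rw [show t + (m + 1) = t + 1 + m by ring, hfper]
  -- invariance over one turn
  have hb' : ∀ t, Phi φ Y (t + (m + 1)) (Y (t + m)) = f t := by
    intro t
    have := hback (t + m)
    rw [hfper, show t + m + 1 = t + (m + 1) by ring, hYm'] at this
    exact this
  have hf' : ∀ t, Phi φ Y (t + (m + 1)) (Y (t + 1)) = f (t + 1) := by
    intro t
    rw [← hfm, ← hf, hYm]
  have hout2 : ∀ t c, (A (Y t) (Y (t + 1)) ∧ f t = c ∨
      A (Y t) (Y (t + m)) ∧ Phi φ Y t (Y (t + m)) = c) ↔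
      (A (Y t) (Y (t + 1)) ∧ f (t + 1) = c ∨ A (Y t) (Y (t + m)) ∧ f t = c) := by
    intro t c
    have h1 := hout t c
    have h2 := hout (t + (m + 1)) c
    rw [hper, hYm, hYm', hb', hf'] at h2
    rw [hf] at h1
    rw [h1, h2]
  have hin2 : ∀ t c, (A (Y (t + 1)) (Y t) ∧ f t = c ∨
      A (Y (t + m)) (Y t) ∧ Phi φ Y t (Y (t + m)) = c) ↔
      (A (Y (t + 1)) (Y t) ∧ f (t + 1) = c ∨ A (Y (t + m)) (Y t) ∧ f t = c) := by
    intro t c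
    have h1 := hin t c
    have h2 := hin (t + (m + 1)) c
    simp only [hper, hYm, hYm', hb', hf'] at h2
    simp only [hf] at h1
    rw [h1, h2]
  have hne : ∀ t, Y (t + 1) ≠ Y (t + m) := by
    intro t h
    have := hinj (t + 1) (m - 1) (by omega) (by omega)
    rw [show t + 1 + (m - 1) = t + m by omega] at this
    exact this h.symm
  have hdo : ∀ t, A (Y t) (Y (t + 1)) → A (Y t) (Y (t + m)) →
      f t ≠ Phi φ Y t (Y (t + m)) := by
    intro t h1 h2 h3
    rw [← hf] at h3
    exact hne t ((hL t _ (hgood t)).2 _ _ h1 h2 h3)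
  have hdi : ∀ t, A (Y (t + 1)) (Y t) → A (Y (t + m)) (Y t) →
      f t ≠ Phi φ Y t (Y (t + m)) := by
    intro t h1 h2 h3
    rw [← hf] at h3
    exact hne t ((hL' t _ (hgood t).swap).2 _ _ h1 h2 h3)
  -- start
  have hf0 : φ (Y 1) = f 0 := by rw [← hf]; rfl
  have hst := hin 0 (f 0)
  have hst' : ∃ z, (∀ s, z ≠ Y s) ∧ A z (Y 0) ∧ φ z = f 0 := ⟨w, hoff, hw, by rw [hc, hf0]⟩
  have hst1 : ¬ (A (Y (0 + 1)) (Y 0) ∧ f 0 = f 0 ∨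
      A (Y (0 + m)) (Y 0) ∧ Phi φ Y 0 (Y (0 + m)) = f 0) := by
    rw [← hf 0] at hst' ⊢
    exact fun h => (hin 0 _).1 h hst'
  have hst2 := hst1
  rw [hin2] at hst2
  have hQ0 : ¬ A (Y (0 + 1)) (Y 0) := fun h => hst1 (Or.inl ⟨h, rfl⟩)
  have hPm : ¬ A (Y (0 + m)) (Y 0) := fun h => hst2 (Or.inr ⟨h, rfl⟩)
  have hQm : A (Y 0) (Y (0 + m)) := by
    have := hadj (0 + m)
    rw [show 0 + m + 1 = 0 + (m + 1) by ring, hper] at this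
    exact this.resolve_left hPm
  have hf01 : f 1 ≠ f 0 := by
    have h1 := hdo 0 h0 hQm
    have h2 := (hout2 0 (Phi φ Y 0 (Y (0 + m)))).1 (Or.inr ⟨hQm, rfl⟩)
    rcases h2 with ⟨-, h2⟩ | ⟨-, h2⟩
    · simp only [zero_add] at h1 h2
      rw [h2]; exact h1.symm
    · exact absurd h2 h1
  -- alternation
  have halt : ∀ t, (f (t + 1) ≠ f t) ∧
      (f t = if Even t then f 0 else f 1) ∧
      (f (t + 1) = if Even t then f 1 else f 0) ∧
      (Even t → A (Y t) (Y (t + 1)) ∧ ¬ A (Y (t + 1)) (Y t)) ∧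
      (¬ Even t → ¬ A (Y t) (Y (t + 1)) ∧ A (Y (t + 1)) (Y t)) := by
    intro t
    induction t with
    | zero => simp [hf01, h0]; simpa using hQ0
    | succ t ih =>
      obtain ⟨i1, i2, i3, i4, i5⟩ := ih
      have ho := hout2 (t + 1)
      have hi := hin2 (t + 1)
      have hdo1 := hdo (t + 1)
      have hdi1 := hdi (t + 1)
      have had := hadj (t + 1)
      simp only [hY1] at ho hi hdo1 hdi1
      have ho1 := ho (f t)
      have ho2 := ho (f (t + 1))
      have hi1 := hi (f t)
      have hi2 := hi (f (t + 1))
      by_cases he : Even t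
      · have he' : ¬ Even (t + 1) := by simpa [Nat.even_add_one] using he
        simp only [he, he', if_true, if_false, not_true, not_false_iff, true_imp_iff,
          false_imp_iff] at *
        grind
      · have he' : Even (t + 1) := by simpa [Nat.even_add_one] using he
        simp only [he, he', if_true, if_false, not_true, not_false_iff, true_imp_iff,
          false_imp_iff] at *
        grind
  have hm1 := halt m
  have hm2 := halt (m + 1)
  have hp0 : f m = f 0 := by simpa using hfper 0
  have hYp : Y (m + 1) = Y 0 := by simpa using hper 0
  have hYp1 : Y (m + 1 + 1) = Y 1 := by simpa using hYm 0
  by_cases he : Even m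
  · have he' : ¬ Even (m + 1) := by simpa [Nat.even_add_one] using he
    have := (hm2.2.2.2.2 he').1
    rw [hYp, hYp1] at this
    exact this h0
  · have := hm1.2.1
    rw [if_neg he, hp0] at this
    exact hf01 this.symm

end cyc

end Gallai
namespace Gallai

lemma path_of_rtg {r : ℕ → ℕ → Prop} {a b : ℕ} (h : Relation.ReflTransGen r a b) :
    ∃ (l : ℕ) (g : ℕ → ℕ), g 0 = a ∧ g l = b ∧ ∀ i < l, r (g i) (g (i + 1)) := by
  induction h using Relation.ReflTransGen.head_induction_on with
  | refl => exact ⟨0, fun _ => b, rfl, rfl, by simp⟩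
  | @head a c hac _ ih =>
    obtain ⟨l, g, h0, hl, hg⟩ := ih
    refine ⟨l + 1, fun i => if i = 0 then a else g (i - 1), by simp, by simp [hl], ?_⟩
    intro i hi
    rcases i with _ | i
    · simpa [h0] using hac
    · simpa using hg i (by omega)

/-- Closed walks through the edge `vu` meeting `v` only at the ends and not ending with `u`. -/
def CW (E : ℕ → ℕ → Prop) (v u m : ℕ) (y : ℕ → ℕ) : Prop :=
  1 ≤ m ∧ y 0 = v ∧ y 1 = u ∧ y (m + 1) = v ∧ y m ≠ u ∧
    (∀ i, 1 ≤ i → i ≤ m → y i ≠ v) ∧ ∀ i ≤ m, E (y i) (y (i + 1))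

/-- cut out `d` steps after position `i` -/
lemma CW.splice {E : ℕ → ℕ → Prop} {v u m : ℕ} {y : ℕ → ℕ} (h : CW E v u m y)
    (i d : ℕ) (hi : 1 ≤ i) (hid : i + d ≤ m) (hE : E (y i) (y (i + d + 1)))
    (hend : i + d = m → y i ≠ u) :
    CW E v u (m - d) (fun s => if s ≤ i then y s else y (s + d)) := by
  obtain ⟨h1, h2, h3, h4, h5, h6, h7⟩ := h
  refine ⟨by omega, by simp [h2], by simp [hi, h3], ?_, ?_, ?_, ?_⟩
  · have : ¬ (m - d + 1 ≤ i) := by omega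
    simp only [this, if_false]
    rw [show m - d + 1 + d = m + 1 by omega, h4]
  · by_cases hh : m - d ≤ i
    · simp only [hh, if_true]
      rw [show m - d = i by omega]
      exact hend (by omega)
    · simp only [hh, if_false]
      rw [show m - d + d = m by omega]
      exact h5
  · intro j hj1 hj2
    by_cases hh : j ≤ i
    · simp only [hh, if_true]; exact h6 j hj1 (by omega)
    · simp only [hh, if_false]; exact h6 _ (by omega) (by omega)
  · intro j hj
    rcases lt_trichotomy j i with hh | rfl | hh
    · simp only [hh.le, if_true, show j + 1 ≤ i from hh]
      exact h7 j (by omega)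
    · simp only [le_refl, if_true, show ¬ (j + 1 ≤ j) by omega, if_false]
      rw [show j + 1 + d = j + d + 1 by ring]; exact hE
    · simp only [show ¬ (j ≤ i) by omega, show ¬ (j + 1 ≤ i) by omega, if_false]
      rw [show j + 1 + d = j + d + 1 by ring]; exact h7 _ (by omega)

/-- An induced cycle through the edge `vu`. -/
lemma exists_cycle {E : ℕ → ℕ → Prop} (hs : ∀ a b, E a b → E b a) {v u : ℕ}
    (hex : ∃ m y, CW E v u m y) :
    ∃ (m : ℕ) (Y : ℕ → ℕ), 2 ≤ m ∧ Y 0 = v ∧ Y 1 = u ∧ (∀ t, Y (t + (m + 1)) = Y t) ∧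
      (∀ t j, 1 ≤ j → j ≤ m → Y (t + j) ≠ Y t) ∧
      (∀ t, E (Y t) (Y (t + 1))) ∧
      (∀ t j, 2 ≤ j → j < m → ¬ E (Y t) (Y (t + j))) := by
  classical
  obtain ⟨y, hy⟩ := Nat.find_spec hex
  have hmin : ∀ m' < Nat.find hex, ∀ y', ¬ CW E v u m' y' :=
    fun m' hm' y' h => Nat.find_min hex hm' ⟨y', h⟩
  generalize Nat.find hex = m at hy hmin
  have hy' := hy
  obtain ⟨h1, h2, h3, h4, h5, h6, h7⟩ := hy'
  have hm2 : 2 ≤ m := by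
    rcases Nat.lt_or_ge m 2 with h | h
    · obtain rfl : m = 1 := by omega
      exact absurd h3 h5
    · exact h
  have hinj0 : ∀ i j, 1 ≤ i → i < j → j ≤ m → y i ≠ y j := by
    intro i j hi hij hj he
    refine hmin (m - (j - i)) (by omega) _ (hy.splice i (j - i) hi (by omega) ?_ ?_)
    · rw [show i + (j - i) + 1 = j + 1 by omega, he]
      exact h7 j hj
    · intro hh
      rw [he, show j = m by omega]
      exact h5
  have hinj : ∀ i j, i < j → j ≤ m → y i ≠ y j := by
    intro i j hij hj
    rcases Nat.eq_zero_or_pos i with rfl | hi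
    · rw [h2]; exact (h6 j (by omega) hj).symm
    · exact hinj0 i j hi hij hj
  have hch0 : ∀ i j, 1 ≤ i → i + 2 ≤ j → j ≤ m + 1 → (j = m + 1 → 2 ≤ i) →
      ¬ E (y i) (y j) := by
    intro i j hi hij hj hj2 he
    refine hmin (m - (j - i - 1)) (by omega) _
      (hy.splice i (j - i - 1) hi (by omega) ?_ ?_)
    · rw [show i + (j - i - 1) + 1 = j by omega]; exact he
    · intro hh
      rw [← h3]
      exact (hinj 1 i (by have := hj2 (by omega); omega) (by omega)).symm
  have hch : ∀ i j, i + 2 ≤ j → j ≤ m → (i = 0 → j < m) → ¬ E (y i) (y j) := by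
    intro i j hij hj hh he
    rcases Nat.eq_zero_or_pos i with rfl | hi
    · have := hh rfl
      rw [h2, ← h4] at he
      exact hch0 j (m + 1) (by omega) (by omega) le_rfl (by omega) (hs _ _ he)
    · exact hch0 i j hi hij (by omega) (by omega) he
  -- periodic extension
  have hmod : ∀ t j, j ≤ m → (t + j) % (m + 1) =
      if t % (m + 1) + j ≤ m then t % (m + 1) + j else t % (m + 1) + j - (m + 1) := by
    intro t j hj
    have hlt := Nat.mod_lt t (Nat.succ_pos m)
    rw [Nat.succ_eq_add_one] at hlt
    rw [Nat.add_mod, Nat.mod_eq_of_lt (show j < m + 1 by omega)]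
    split_ifs with h
    · exact Nat.mod_eq_of_lt (by omega)
    · rw [Nat.mod_eq_sub_mod (by omega)]
      exact Nat.mod_eq_of_lt (by omega)
  refine ⟨m, fun t => y (t % (m + 1)), hm2, by simp [h2], ?_, ?_, ?_, ?_, ?_⟩
  · show y (1 % (m + 1)) = u
    rw [Nat.mod_eq_of_lt (by omega), h3]
  · intro t; simp
  · intro t j hj1 hj2
    show y ((t + j) % (m + 1)) ≠ y (t % (m + 1))
    have hlt := Nat.mod_lt t (Nat.succ_pos m)
    rw [Nat.succ_eq_add_one] at hlt
    rw [hmod t j hj2]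
    split_ifs with h
    · exact (hinj _ _ (by omega) (by omega)).symm
    · exact hinj _ _ (by omega) (by omega)
  · intro t
    show E (y (t % (m + 1))) (y ((t + 1) % (m + 1)))
    have hlt := Nat.mod_lt t (Nat.succ_pos m)
    rw [Nat.succ_eq_add_one] at hlt
    rw [hmod t 1 (by omega)]
    split_ifs with h
    · exact h7 _ (by omega)
    · rw [show t % (m + 1) = m by omega, show m + 1 - (m + 1) = 0 by omega, h2, ← h4]
      exact h7 m le_rfl
  · intro t j hj1 hj2
    show ¬ E (y (t % (m + 1))) (y ((t + j) % (m + 1)))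
    have hlt := Nat.mod_lt t (Nat.succ_pos m)
    rw [Nat.succ_eq_add_one] at hlt
    rw [hmod t j (by omega)]
    split_ifs with h
    · exact hch _ _ (by omega) (by omega) (by omega)
    · intro he
      exact hch _ _ (by omega) (by omega) (by omega) (hs _ _ he)

open Digr

lemma arc_ne (D : Digr) {a b : ℕ} (h : (a, b) ∈ D.arcs) : a ≠ b := D.no_loops _ h

lemma colorable_some (D : Digr) : ∃ n, D.Colorable n := by
  refine ⟨D.verts.sup id + 1, fun x => Fin.ofNat _ x, ?_⟩
  intro v hv
  obtain ⟨y, ⟨hy, he⟩, -⟩ := Relation.TransGen.head'_iff.1 hv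
  have h := D.arcs_sub _ hy
  have h1 : v ≤ D.verts.sup id := Finset.le_sup (f := id) h.1
  have h2 : y ≤ D.verts.sup id := Finset.le_sup (f := id) h.2
  have := congrArg Fin.val he
  simp only [Fin.ofNat] at this
  rw [Nat.mod_eq_of_lt (by omega), Nat.mod_eq_of_lt (by omega)] at this
  exact arc_ne D hy this

lemma colorable_dichrom (D : Digr) : D.Colorable D.dichrom :=
  Nat.sInf_mem (s := {n | D.Colorable n}) (colorable_some D)

lemma colorable_mono (D : Digr) {a b : ℕ} (h : a ≤ b) (hc : D.Colorable a) : D.Colorable b := by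
  obtain ⟨φ, hφ⟩ := hc
  refine ⟨fun x => Fin.castLE h (φ x), ?_⟩
  intro v hv
  refine hφ v (Relation.TransGen.mono ?_ _ _ hv)
  rintro x y ⟨h1, h2⟩
  exact ⟨h1, Fin.castLE_injective h h2⟩

lemma exists_good {n : ℕ} {D : Digr} (hD : D.Critical (n + 1)) {v : ℕ} (hv : v ∈ D.verts) :
    ∃ φ : ℕ → Fin n, Good (fun x y => (x, y) ∈ D.arcs) v φ := by
  have h := hD.2 (D.delete v) ⟨Finset.erase_subset _ _, Finset.filter_subset _ _⟩ (by
    intro h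
    have h2 : v ∈ (D.delete v).verts := by rw [h]; exact hv
    exact (Finset.mem_erase.1 h2).1 rfl)
  obtain ⟨φ, hφ⟩ := colorable_mono _ (Nat.lt_succ_iff.1 h) (colorable_dichrom (D.delete v))
  refine ⟨φ, fun x hx => hφ x (Relation.TransGen.mono ?_ _ _ hx)⟩
  rintro a b ⟨⟨h1, h2, h3⟩, h4⟩
  exact ⟨Finset.mem_filter.2 ⟨h1, h2, h3⟩, h4⟩

lemma not_colorable {n : ℕ} {D : Digr} (hD : D.Critical (n + 1)) : ¬ D.Colorable n := by
  intro h
  have : D.dichrom ≤ n := Nat.sInf_le h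
  have := hD.1
  omega

lemma low_aux {n : ℕ} (A : ℕ → ℕ → Prop) (hA : ∀ x, ¬ A x x)
    (hnc : ∀ φ : ℕ → Fin n, ∃ x, Relation.TransGen (fun x y => A x y ∧ φ x = φ y) x x)
    (v : ℕ) (S : Finset ℕ) (hS : ∀ y, y ∈ S ↔ A v y) (hcard : S.card = n) : Low n A v := by
  intro φ hφ
  have hsurj : ∀ c, ∃ y, A v y ∧ φ y = c := by
    intro c
    by_contra hcon
    push Not at hcon
    obtain ⟨x, hx⟩ := hnc (Function.update φ v c)
    refine acyc_of_no_out _ _ v ?_ ?_ hφ x hx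
    · rintro y ⟨h1, h2⟩
      have hyv : y ≠ v := by rintro rfl; exact hA _ h1
      rw [Function.update_self, Function.update_of_ne hyv] at h2
      exact hcon y h1 h2.symm
    · rintro a b ⟨h1, h2⟩ ha hb
      rw [Function.update_of_ne ha, Function.update_of_ne hb] at h2
      exact ⟨⟨h1, ha, hb⟩, h2⟩
  refine ⟨hsurj, ?_⟩
  have himg : S.image φ = Finset.univ := by
    ext c
    simp only [Finset.mem_image, Finset.mem_univ, iff_true]
    obtain ⟨y, h1, h2⟩ := hsurj c
    exact ⟨y, (hS y).2 h1, h2⟩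
  have hinj : Set.InjOn φ S := by
    apply Finset.card_image_iff.1
    rw [himg, hcard]; simp
  intro y z hy hz h
  exact hinj ((hS y).2 hy) ((hS z).2 hz) h

lemma low_of_mem {n : ℕ} {D : Digr} (hD : D.Critical (n + 1)) {v : ℕ}
    (hv : v ∈ D.lowVerts (n + 1)) :
    Low n (fun x y => (x, y) ∈ D.arcs) v ∧ Low n (fun x y => (y, x) ∈ D.arcs) v := by
  have hnc := not_colorable hD
  obtain ⟨hv1, hv2, hv3⟩ := Finset.mem_filter.1 hv
  have hnc1 : ∀ φ : ℕ → Fin n, ∃ x, Relation.TransGen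
      (fun x y => (x, y) ∈ D.arcs ∧ φ x = φ y) x x := by
    intro φ
    by_contra h
    push Not at h
    exact hnc ⟨φ, h⟩
  constructor
  · refine low_aux _ (fun x h => arc_ne D h rfl) hnc1 v (D.outNbrs v) ?_ hv2
    intro y
    exact ⟨fun h => (Finset.mem_filter.1 h).2, fun h => Finset.mem_filter.2 ⟨(D.arcs_sub _ h).2, h⟩⟩
  · refine low_aux _ (fun x h => arc_ne D h rfl) ?_ v (D.inNbrs v) ?_ hv3
    · intro φ
      obtain ⟨x, hx⟩ := hnc1 φ
      refine ⟨x, ?_⟩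
      rw [← Relation.transGen_swap] at hx
      refine Relation.TransGen.mono ?_ _ _ hx
      rintro a b ⟨h1, h2⟩
      exact ⟨h1, h2.symm⟩
    · intro y
      exact ⟨fun h => (Finset.mem_filter.1 h).2,
        fun h => Finset.mem_filter.2 ⟨(D.arcs_sub _ h).1, h⟩⟩

/-- A block is an induced subdigraph. -/
lemma block_induced {B H : Digr} (hB : IsBlock B H) {a b : ℕ} (ha : a ∈ B.verts)
    (hb : b ∈ B.verts) (hab : (a, b) ∈ H.arcs) : (a, b) ∈ B.arcs := by
  obtain ⟨h1, h2, h3, h4⟩ := hB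
  have hsub : B.Sub (H.induce B.verts) := by
    refine ⟨fun x hx => Finset.mem_inter.2 ⟨h1.1 hx, hx⟩, fun x hx => ?_⟩
    exact Finset.mem_filter.2 ⟨h1.2 hx, B.arcs_sub x hx⟩
  have heq := h4 (H.induce B.verts) ⟨Finset.inter_subset_left, Finset.filter_subset _ _⟩
    ?_ ?_ hsub
  · rw [← heq]
    exact Finset.mem_filter.2 ⟨hab, ha, hb⟩
  · intro x hx y hy
    refine Relation.ReflTransGen.mono ?_ _ _
      (h2 x (Finset.mem_inter.1 hx).2 y (Finset.mem_inter.1 hy).2)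
    intro p q hpq
    exact hpq.imp (fun h => hsub.2 h) (fun h => hsub.2 h)
  · intro v hv x hx y hy
    have hx' := Finset.mem_erase.1 hx
    have hy' := Finset.mem_erase.1 hy
    refine Relation.ReflTransGen.mono ?_ _ _
      (h3 v (Finset.mem_inter.1 hv).2 x
        (Finset.mem_erase.2 ⟨hx'.1, (Finset.mem_inter.1 hx'.2).2⟩) y
        (Finset.mem_erase.2 ⟨hy'.1, (Finset.mem_inter.1 hy'.2).2⟩))
    intro p q hpq
    have key : ∀ e, e ∈ (B.delete v).arcs → e ∈ ((H.induce B.verts).delete v).arcs := by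
      intro e he
      obtain ⟨e1, e2⟩ := Finset.mem_filter.1 he
      exact Finset.mem_filter.2 ⟨hsub.2 e1, e2⟩
    exact hpq.imp (fun h => key _ h) (fun h => key _ h)

lemma exists_CW {B : Digr} (hns : B.NoSepVertex) (hcard : 3 ≤ B.verts.card) {v u : ℕ}
    (huv : (v, u) ∈ B.arcs ∨ (u, v) ∈ B.arcs) :
    ∃ m y, CW (fun a b => (a, b) ∈ B.arcs ∨ (b, a) ∈ B.arcs) v u m y := by
  have hv : v ∈ B.verts := by
    rcases huv with h | h
    · exact (B.arcs_sub _ h).1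
    · exact (B.arcs_sub _ h).2
  have hu : u ∈ B.verts := by
    rcases huv with h | h
    · exact (B.arcs_sub _ h).2
    · exact (B.arcs_sub _ h).1
  have hne : v ≠ u := by
    rcases huv with h | h
    · exact arc_ne B h
    · exact (arc_ne B h).symm
  have hdel : ∀ {w a b : ℕ}, ((a, b) ∈ (B.delete w).arcs ∨ (b, a) ∈ (B.delete w).arcs) →
      ((a, b) ∈ B.arcs ∨ (b, a) ∈ B.arcs) ∧ a ≠ w ∧ b ≠ w := by
    rintro w a b (h | h)
    · obtain ⟨h1, h2, h3⟩ := Finset.mem_filter.1 h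
      exact ⟨Or.inl h1, h2, h3⟩
    · obtain ⟨h1, h2, h3⟩ := Finset.mem_filter.1 h
      exact ⟨Or.inr h1, h3, h2⟩
  obtain ⟨z, hz, hzv, hzu⟩ : ∃ z ∈ B.verts, z ≠ v ∧ z ≠ u := by
    by_contra hcon
    push Not at hcon
    have hsub : B.verts ⊆ {v, u} := by
      intro z hz
      by_cases h : z = v
      · simp [h]
      · simp [hcon z hz h]
    have := Finset.card_le_card hsub
    have := Finset.card_le_two (a := v) (b := u)
    omega
  obtain ⟨x, hxu, hvx⟩ : ∃ x, x ≠ u ∧ ((v, x) ∈ B.arcs ∨ (x, v) ∈ B.arcs) := by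
    have hp := hns u hu v (Finset.mem_erase.2 ⟨hne, hv⟩) z (Finset.mem_erase.2 ⟨hzu, hz⟩)
    rcases Relation.ReflTransGen.cases_head hp with h | ⟨x, hx, -⟩
    · exact absurd h.symm hzv
    · obtain ⟨h1, h2, h3⟩ := hdel hx
      exact ⟨x, h3, h1⟩
  have hx : x ∈ B.verts := by
    rcases hvx with h | h
    · exact (B.arcs_sub _ h).2
    · exact (B.arcs_sub _ h).1
  have hxv : x ≠ v := by
    rcases hvx with h | h
    · exact (arc_ne B h).symm
    · exact arc_ne B h
  obtain ⟨l, g, hg0, hgl, hg⟩ := path_of_rtg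
    (hns v hv u (Finset.mem_erase.2 ⟨hne.symm, hu⟩) x (Finset.mem_erase.2 ⟨hxv, hx⟩))
  have hgv : ∀ i ≤ l, g i ≠ v := by
    intro i hi
    rcases Nat.lt_or_ge i l with h | h
    · exact (hdel (hg i h)).2.1
    · rw [show i = l by omega, hgl]; exact hxv
  refine ⟨l + 1, fun s => if s = 0 then v else if s ≤ l + 1 then g (s - 1) else v,
    by omega, by simp, by simp [hg0], by simp, by simpa [hgl] using hxu, ?_, ?_⟩
  · intro i hi1 hi2
    simp only [show i ≠ 0 by omega, hi2, if_true, if_false]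
    exact hgv _ (by omega)
  · intro i hi
    rcases Nat.eq_zero_or_pos i with rfl | hi0
    · simpa [hg0] using huv
    · obtain ⟨i, rfl⟩ : ∃ j, i = j + 1 := ⟨i - 1, by omega⟩
      rcases Nat.lt_or_ge i l with h | h
      · have := (hdel (hg i h)).1
        simpa [hi, show i ≤ l by omega, show i + 1 ≤ l by omega] using this
      · obtain rfl : i = l := by omega
        simpa [hgl] using hvx.symm

/-- Core step, for an arc relation `A` and a set `S` inducing the symmetric relation `E`. -/
lemma core {n : ℕ} {A E : ℕ → ℕ → Prop} (hA : ∀ x, ¬ A x x) (S : ℕ → Prop)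
    (hL : ∀ v, S v → Low n A v) (hL' : ∀ v, S v → Low n (fun x y => A y x) v)
    (hES : ∀ a b, E a b → S a) (hE : ∀ a b, S a → S b → (E a b ↔ A a b ∨ A b a))
    {v u w : ℕ} {φ : ℕ → Fin n} (hφ : Good A v φ) (hex : ∃ m y, CW E v u m y)
    (hs : ∀ a b, E a b → E b a)
    (hu : A v u) (hw : A w v) (hc : φ w = φ u) : S w := by
  by_contra hcon
  obtain ⟨m, Y, hm, rfl, rfl, hper, hinj, hadj, hch⟩ := exists_cycle hs hex
  have hS : ∀ t, S (Y t) := fun t => hES _ _ (hadj t)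
  refine cycle_lemma hA hm (fun t => hL _ (hS t)) (fun t => hL' _ (hS t)) hper hinj
    (fun t => (hE _ _ (hS _) (hS _)).1 (hadj t)) ?_ ?_ hφ w hu hw hc ?_
  · intro t j h1 h2 h3
    exact hch t j h1 h2 ((hE _ _ (hS _) (hS _)).2 (Or.inl h3))
  · intro t j h1 h2 h3
    exact hch t j h1 h2 ((hE _ _ (hS _) (hS _)).2 (Or.inr h3))
  · rintro s rfl
    exact hcon (hS s)

end Gallai

open Digr in
/-- Let `D` be a `k`-critical digraph, `D_L` the subdigraph of `D`
induced by the vertices of out-degree and in-degree `k - 1`, and `B` a block of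
`D_L` with at least 3 vertices. Then every vertex of `B` has equal out- and
in-degree in `B`; in particular, `B` is Eulerian. -/
theorem gallai_block_eulerian (k : ℕ) (D : Digr) (hD : D.Critical k)
    (B : Digr) (hB : IsBlock B (D.induce (D.lowVerts k)))
    (hcard : 3 ≤ B.verts.card) :
    ∀ v ∈ B.verts, B.outDeg v = B.inDeg v := by
  intro v hv
  obtain ⟨n, rfl⟩ : ∃ n, k = n + 1 := by
    rcases k with _ | n
    · exfalso
      have hvD : v ∈ D.verts := (Finset.mem_inter.1 (hB.1.1 hv)).1
      have h := hD.2 (D.delete v) ⟨Finset.erase_subset _ _, Finset.filter_subset _ _⟩ (by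
        intro h
        have h2 : v ∈ (D.delete v).verts := by rw [h]; exact hvD
        exact (Finset.mem_erase.1 h2).1 rfl)
      exact absurd h (Nat.not_lt_zero _)
    · exact ⟨n, rfl⟩
  have hBlow : ∀ x ∈ B.verts, x ∈ D.lowVerts (n + 1) :=
    fun x hx => (Finset.mem_inter.1 (hB.1.1 hx)).2
  have harc : ∀ a b, a ∈ B.verts → b ∈ B.verts → ((a, b) ∈ B.arcs ↔ (a, b) ∈ D.arcs) := by
    intro a b ha hb
    constructor
    · intro h
      exact (Finset.mem_filter.1 (hB.1.2 h)).1
    · intro h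
      exact Gallai.block_induced hB ha hb (Finset.mem_filter.2 ⟨h, hBlow a ha, hBlow b hb⟩)
  obtain ⟨φ, hφ⟩ := Gallai.exists_good hD (Finset.mem_inter.1 (hB.1.1 hv)).1
  obtain ⟨hLo, hLi⟩ := Gallai.low_of_mem hD (hBlow v hv)
  obtain ⟨ho1, ho2⟩ := hLo φ hφ
  obtain ⟨hi1, hi2⟩ := hLi φ hφ.swap
  have hES : ∀ a b, ((a, b) ∈ B.arcs ∨ (b, a) ∈ B.arcs) → a ∈ B.verts := by
    rintro a b (h | h)
    · exact (B.arcs_sub _ h).1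
    · exact (B.arcs_sub _ h).2
  have hmo : ∀ y, y ∈ B.outNbrs v ↔ y ∈ B.verts ∧ (v, y) ∈ D.arcs := by
    intro y
    constructor
    · intro h
      obtain ⟨h1, h2⟩ := Finset.mem_filter.1 h
      exact ⟨h1, (harc _ _ hv h1).1 h2⟩
    · rintro ⟨h1, h2⟩
      exact Finset.mem_filter.2 ⟨h1, (harc _ _ hv h1).2 h2⟩
  have hmi : ∀ y, y ∈ B.inNbrs v ↔ y ∈ B.verts ∧ (y, v) ∈ D.arcs := by
    intro y
    constructor
    · intro h
      obtain ⟨h1, h2⟩ := Finset.mem_filter.1 h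
      exact ⟨h1, (harc _ _ h1 hv).1 h2⟩
    · rintro ⟨h1, h2⟩
      exact Finset.mem_filter.2 ⟨h1, (harc _ _ h1 hv).2 h2⟩
  have himg : (B.outNbrs v).image φ = (B.inNbrs v).image φ := by
    ext c
    simp only [Finset.mem_image, hmo, hmi]
    constructor
    · rintro ⟨u, ⟨hu, hvu⟩, rfl⟩
      obtain ⟨w, hw, hwc⟩ := hi1 (φ u)
      refine ⟨w, ⟨?_, hw⟩, hwc⟩
      exact Gallai.core (A := fun x y => (x, y) ∈ D.arcs)
        (E := fun a b => (a, b) ∈ B.arcs ∨ (b, a) ∈ B.arcs)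
        (fun x h => Gallai.arc_ne D h rfl) (fun x => x ∈ B.verts)
        (fun x hx => (Gallai.low_of_mem hD (hBlow x hx)).1)
        (fun x hx => (Gallai.low_of_mem hD (hBlow x hx)).2) hES
        (fun a b ha hb => by rw [harc a b ha hb, harc b a hb ha]) hφ
        (Gallai.exists_CW hB.2.2.1 hcard (Or.inl ((harc _ _ hv hu).2 hvu)))
        (fun a b h => h.symm) hvu hw hwc
    · rintro ⟨u, ⟨hu, hvu⟩, rfl⟩
      obtain ⟨w, hw, hwc⟩ := ho1 (φ u)
      refine ⟨w, ⟨?_, hw⟩, hwc⟩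
      exact Gallai.core (A := fun x y => (y, x) ∈ D.arcs)
        (E := fun a b => (a, b) ∈ B.arcs ∨ (b, a) ∈ B.arcs)
        (fun x h => Gallai.arc_ne D h rfl) (fun x => x ∈ B.verts)
        (fun x hx => (Gallai.low_of_mem hD (hBlow x hx)).2)
        (fun x hx => (Gallai.low_of_mem hD (hBlow x hx)).1) hES
        (fun a b ha hb => by rw [harc a b ha hb, harc b a hb ha, or_comm]) hφ.swap
        (Gallai.exists_CW hB.2.2.1 hcard (Or.inr ((harc _ _ hu hv).2 hvu)))
        (fun a b h => h.symm) hvu hw hwc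
  have hc1 : ((B.outNbrs v).image φ).card = (B.outNbrs v).card := by
    apply Finset.card_image_of_injOn
    intro y hy z hz h
    exact ho2 _ _ ((hmo y).1 hy).2 ((hmo z).1 hz).2 h
  have hc2 : ((B.inNbrs v).image φ).card = (B.inNbrs v).card := by
    apply Finset.card_image_of_injOn
    intro y hy z hz h
    exact hi2 _ _ ((hmi y).1 hy).2 ((hmi z).1 hz).2 h
  show (B.outNbrs v).card = (B.inNbrs v).card
  rw [← hc1, ← hc2, himg]
end

section
/- Let k ≥ 3 and let D be a (k+1)-critical digraph without digons that is not the bidirected complete graph on k+1 vertices. Then 2·|A(D)| ≥ (2k + (2k − 2)/((2k + 1)² − 3)) · |V(D)|. -/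
namespace GB

structure Sys (k : ℕ) (L : Set ℕ) (O I : ℕ → Set ℕ) (G : (ℕ → Fin k) → ℕ → Prop) : Prop where
  ex : ∀ v ∈ L, ∃ φ, G φ v
  injO : ∀ φ, ∀ v ∈ L, G φ v → Set.InjOn φ (O v)
  injI : ∀ φ, ∀ v ∈ L, G φ v → Set.InjOn φ (I v)
  surO : ∀ φ, ∀ v ∈ L, G φ v → ∀ c, ∃ w ∈ O v, φ w = c
  surI : ∀ φ, ∀ v ∈ L, G φ v → ∀ c, ∃ w ∈ I v, φ w = c
  shO : ∀ φ, ∀ v ∈ L, G φ v → ∀ u ∈ O v, G (Function.update φ v (φ u)) u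
  shI : ∀ φ, ∀ v ∈ L, G φ v → ∀ u ∈ I v, G (Function.update φ v (φ u)) u
  sym : ∀ u v, u ∈ O v ↔ v ∈ I u
  dis : ∀ u v, u ∈ O v → u ∉ I v

variable {k : ℕ} {L : Set ℕ} {O I : ℕ → Set ℕ} {G : (ℕ → Fin k) → ℕ → Prop}

theorem Sys.swap (h : Sys k L O I G) : Sys k L I O G where
  ex := h.ex
  injO := h.injI
  injI := h.injO
  surO := h.surI
  surI := h.surO
  shO := h.shI
  shI := h.shO
  sym := fun u v => (h.sym v u).symm
  dis := fun u v h1 h2 => h.dis u v h2 h1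

theorem Sys.asym (h : Sys k L O I G) {u v : ℕ} (a : u ∈ O v ∨ u ∈ I v) : v ∈ O u ∨ v ∈ I u := by
  rcases a with a | a
  · exact Or.inr ((h.sym _ _).1 a)
  · exact Or.inl ((h.sym _ _).2 a)

structure Cyc (L : Set ℕ) (O I : ℕ → Set ℕ) (c : ℕ → ℕ) (n : ℕ) : Prop where
  three : 3 ≤ n
  inj : ∀ i j, c i = c j ↔ i % n = j % n
  mem : ∀ i, c i ∈ L
  adj : ∀ i, c (i + 1) ∈ O (c i) ∨ c (i + 1) ∈ I (c i)

theorem Cyc.swap {c : ℕ → ℕ} {n : ℕ} (h : Cyc L O I c n) : Cyc L I O c n :=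
  ⟨h.three, h.inj, h.mem, fun i => (h.adj i).symm⟩

theorem Cyc.per {c : ℕ → ℕ} {n : ℕ} (h : Cyc L O I c n) (i : ℕ) : c (i + n) = c i := by
  rw [h.inj]; simp

theorem Cyc.per0 {c : ℕ → ℕ} {n : ℕ} (h : Cyc L O I c n) : c n = c 0 := by
  rw [h.inj]; simp

theorem Cyc.red {c : ℕ → ℕ} {n : ℕ} (h : Cyc L O I c n) (i : ℕ) : c (i % n) = c i := by
  rw [h.inj]; simp

theorem Cyc.lt_inj {c : ℕ → ℕ} {n : ℕ} (h : Cyc L O I c n) {i j : ℕ} (hi : i < n) (hj : j < n)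
    (e : c i = c j) : i = j := by
  rw [h.inj, Nat.mod_eq_of_lt hi, Nat.mod_eq_of_lt hj] at e; exact e

theorem Cyc.shift {c : ℕ → ℕ} {n : ℕ} (h : Cyc L O I c n) (t : ℕ) :
    Cyc L O I (fun i => c (i + t)) n where
  three := h.three
  inj := fun i j => by
    simp only [h.inj]
    exact ⟨fun e => Nat.ModEq.add_right_cancel' t e, fun e => Nat.ModEq.add_right t e⟩
  mem := fun i => h.mem _
  adj := fun i => by
    have := h.adj (i + t)
    rwa [show i + t + 1 = i + 1 + t by ring] at this

theorem Cyc.sub {c : ℕ → ℕ} {n : ℕ} (h : Cyc L O I c n) (a b : ℕ) (hab : a + 2 ≤ b)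
    (hb : b < a + n) (hadj : c a ∈ O (c b) ∨ c a ∈ I (c b)) :
    Cyc L O I (fun i => c (a + i % (b - a + 1))) (b - a + 1) where
  three := by omega
  inj := fun i j => by
    have h1 := Nat.mod_lt i (show b - a + 1 > 0 by omega)
    have h2 := Nat.mod_lt j (show b - a + 1 > 0 by omega)
    constructor
    · intro e
      simp only [h.inj] at e
      have e' := Nat.ModEq.add_left_cancel' a e
      exact Nat.ModEq.eq_of_lt_of_lt e' (by omega) (by omega)
    · intro e; simp only [e]
  mem := fun i => h.mem _
  adj := fun i => by
    have h1 := Nat.mod_lt i (show b - a + 1 > 0 by omega)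
    by_cases hi : i % (b - a + 1) = b - a
    · have : (i + 1) % (b - a + 1) = 0 := by
        rw [Nat.add_mod, hi, Nat.mod_eq_of_lt (show 1 < b - a + 1 by omega), Nat.mod_self]
      simp only [hi, this]
      rw [show a + (b - a) = b by omega]
      simpa using hadj
    · have : (i + 1) % (b - a + 1) = i % (b - a + 1) + 1 := by
        rw [Nat.add_mod, Nat.mod_eq_of_lt (show 1 < b - a + 1 by omega), Nat.mod_eq_of_lt]
        omega
      simp only [this]
      exact h.adj _

theorem rot (S : Sys k L O I G) {c : ℕ → ℕ} {n : ℕ} (h : Cyc L O I c n) (φ : ℕ → Fin k)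
    (hφ : G φ (c 0)) : ∃ ψ, G ψ (c 0) ∧
      (∀ i, ψ (c (1 + i % (n - 1))) = φ (c (1 + (i + 1) % (n - 1)))) ∧
      ∀ x, (∀ i, x ≠ c i) → ψ x = φ x := by
  have h3 := h.three
  have key : ∀ t, t + 1 ≤ n → ∃ ψ, G ψ (c t) ∧ (∀ i < t, ψ (c i) = φ (c (i + 1))) ∧
      (∀ i, t < i → i < n → ψ (c i) = φ (c i)) ∧ ∀ x, (∀ i, x ≠ c i) → ψ x = φ x := by
    intro t
    induction t with
    | zero => intro _; exact ⟨φ, hφ, by simp, by simp, by simp⟩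
    | succ t ih =>
      intro ht
      obtain ⟨ψ, g, h1, h2, h4⟩ := ih (by omega)
      refine ⟨Function.update ψ (c t) (ψ (c (t + 1))), ?_, ?_, ?_, ?_⟩
      · rcases h.adj t with ha | ha
        · exact S.shO _ _ (h.mem _) g _ ha
        · exact S.shI _ _ (h.mem _) g _ ha
      · intro i hi
        by_cases e : i = t
        · subst e
          rw [Function.update_self]; exact h2 _ (by omega) (by omega)
        · rw [Function.update_of_ne]
          · exact h1 _ (by omega)
          · intro e'; exact e (h.lt_inj (by omega) (by omega) e')
      · intro i hi hi'
        rw [Function.update_of_ne]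
        · exact h2 _ (by omega) (by omega)
        · intro e'; have := (h.lt_inj (by omega) (by omega) e'); omega
      · intro x hx
        rw [Function.update_of_ne (hx _)]; exact h4 x hx
  obtain ⟨ψ, g, h1, -, h4⟩ := key (n - 1) (by omega)
  have hn : c (n - 1 + 1) = c 0 := by rw [show n - 1 + 1 = n by omega]; exact h.per0
  refine ⟨Function.update ψ (c (n - 1)) (ψ (c 0)), ?_, ?_, ?_⟩
  · have := h.adj (n - 1)
    rw [hn] at this
    rcases this with ha | ha
    · exact S.shO _ _ (h.mem _) g _ ha
    · exact S.shI _ _ (h.mem _) g _ ha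
  · intro i
    have hm := Nat.mod_lt i (show n - 1 > 0 by omega)
    by_cases hi : i % (n - 1) = n - 2
    · have : (i + 1) % (n - 1) = 0 := by
        rw [Nat.add_mod, hi, Nat.mod_eq_of_lt (show 1 < n - 1 by omega),
          show n - 2 + 1 = n - 1 by omega, Nat.mod_self]
      rw [hi, this, show 1 + (n - 2) = n - 1 by omega, Function.update_self]
      exact h1 0 (by omega)
    · have : (i + 1) % (n - 1) = i % (n - 1) + 1 := by
        rw [Nat.add_mod, Nat.mod_eq_of_lt (show 1 < n - 1 by omega), Nat.mod_eq_of_lt]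
        omega
      rw [this, Function.update_of_ne, h1 _ (by omega)]
      · congr 2
      · intro e'; have := (h.lt_inj (by omega) (by omega) e'); omega
  · intro x hx
    rw [Function.update_of_ne (hx _)]; exact h4 x hx

theorem rots (S : Sys k L O I G) {c : ℕ → ℕ} {n : ℕ} (h : Cyc L O I c n) (φ : ℕ → Fin k)
    (hφ : G φ (c 0)) (t : ℕ) : ∃ ψ, G ψ (c 0) ∧
      (∀ i, ψ (c (1 + i % (n - 1))) = φ (c (1 + (i + t) % (n - 1)))) ∧
      ∀ x, (∀ i, x ≠ c i) → ψ x = φ x := by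
  induction t with
  | zero => exact ⟨φ, hφ, by simp, by simp⟩
  | succ t ih =>
    obtain ⟨ψ, g, h1, h2⟩ := ih
    obtain ⟨ψ', g', h1', h2'⟩ := rot S h ψ g
    refine ⟨ψ', g', fun i => ?_, fun x hx => (h2' x hx).trans (h2 x hx)⟩
    rw [h1', h1, show i + 1 + t = i + (t + 1) by ring]

theorem keyK (S : Sys k L O I G) {c : ℕ → ℕ} {n : ℕ} (h : Cyc L O I c n)
    (h1 : c 1 ∈ O (c 0)) (hu : ∀ i, c i ∈ O (c 0) → c i = c 1) :
    ∃ φ α, (∀ i, G φ (c i)) ∧ ∀ i, φ (c i) = α := by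
  have h3 := h.three
  obtain ⟨φ, hφ⟩ := S.ex _ (h.mem 0)
  have hc : ∀ t, φ (c (1 + t % (n - 1))) = φ (c 1) := by
    intro t
    obtain ⟨ψ, g, e1, e2⟩ := rots S h φ hφ t
    have e0 := e1 0
    simp only [Nat.zero_mod, Nat.zero_add, Nat.add_zero] at e0
    rw [← e0]
    obtain ⟨w, hw, hw'⟩ := S.surO φ _ (h.mem 0) hφ (ψ (c 1))
    by_cases hwc : ∃ i, w = c i
    · obtain ⟨i, rfl⟩ := hwc
      rw [← hw', hu i hw]
    · push Not at hwc
      rw [← e2 w hwc] at hw'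
      exact absurd (S.injO ψ _ (h.mem 0) g hw h1 hw') (hwc 1)
  have hc' : ∀ i, c i ≠ c 0 → φ (c i) = φ (c 1) := by
    intro i hi
    rw [← h.red i] at hi ⊢
    have hm := Nat.mod_lt i (show n > 0 by omega)
    have : i % n ≠ 0 := fun e => hi (by rw [e])
    have := hc (i % n - 1)
    rw [Nat.mod_eq_of_lt (by omega), show 1 + (i % n - 1) = i % n by omega] at this
    exact this
  have hall : ∀ i, Function.update φ (c 0) (φ (c 1)) (c i) = φ (c 1) := by
    intro i
    by_cases e : c i = c 0
    · rw [e, Function.update_self]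
    · rw [Function.update_of_ne e]; exact hc' i e
  refine ⟨Function.update φ (c 0) (φ (c 1)), φ (c 1), ?_, hall⟩
  have g1 := S.shO _ _ (h.mem 0) hφ _ h1
  set φ' := Function.update φ (c 0) (φ (c 1)) with hφ'
  have g2 : ∀ i, G φ' (c (1 + i)) := by
    intro i
    induction i with
    | zero => exact g1
    | succ i ih =>
      have e : Function.update φ' (c (1 + i)) (φ' (c (1 + i + 1))) = φ' := by
        rw [hall, ← hall (1 + i), Function.update_eq_self]
      rw [← add_assoc, ← e]
      rcases h.adj (1 + i) with ha | ha
      · exact S.shO _ _ (h.mem _) ih _ ha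
      · exact S.shI _ _ (h.mem _) ih _ ha
  intro i
  have := g2 (i + (n - 1))
  rw [show 1 + (i + (n - 1)) = i + n by omega, h.per] at this
  exact this

theorem keyK' (S : Sys k L O I G) {c : ℕ → ℕ} {n : ℕ} (h : Cyc L O I c n)
    (h1 : c 1 ∈ O (c 0)) (hu : ∀ i, c i ∈ O (c 0) → c i = c 1) (i j l : ℕ) :
    (c j ∈ O (c i) → c l ∈ O (c i) → c j = c l) ∧
    (c j ∈ I (c i) → c l ∈ I (c i) → c j = c l) := by
  obtain ⟨φ, α, g, e⟩ := keyK S h h1 hu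
  exact ⟨fun a b => S.injO φ _ (h.mem i) (g i) a b (by rw [e, e]),
    fun a b => S.injI φ _ (h.mem i) (g i) a b (by rw [e, e])⟩

theorem par (S : Sys k L O I G) {c : ℕ → ℕ} {n : ℕ} (h : Cyc L O I c n)
    (h1 : c 1 ∈ O (c 0)) (h2 : c (n - 1) ∈ O (c 0))
    (hu : ∀ i, c i ∈ O (c 0) → c i = c 1 ∨ c i = c (n - 1)) : Odd n := by
  have h3 := h.three
  obtain ⟨φ, hφ⟩ := S.ex _ (h.mem 0)
  have hab : c 1 ≠ c (n - 1) := fun e => by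
    have := h.lt_inj (by omega) (by omega) e; omega
  have hm1 : (n - 2) % (n - 1) = n - 2 := Nat.mod_eq_of_lt (by omega)
  have step : ∀ t, φ (c (1 + (t + 2) % (n - 1))) = φ (c (1 + t % (n - 1))) := by
    intro t
    obtain ⟨ψ, g, e1, e2⟩ := rots S h φ hφ (t + 1)
    obtain ⟨ψ', g', e1', e2'⟩ := rots S h φ hφ (t + 2)
    have a := e1 0
    have b := e1 (n - 2)
    have a' := e1' 0
    have b' := e1' (n - 2)
    simp only [Nat.zero_mod, Nat.zero_add, Nat.add_zero] at a a'
    rw [hm1, show 1 + (n - 2) = n - 1 by omega] at b b'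
    rw [show n - 2 + (t + 1) = t + (n - 1) by omega, Nat.add_mod_right] at b
    rw [show n - 2 + (t + 2) = t + 1 + (n - 1) by omega, Nat.add_mod_right, ← a] at b'
    rw [← a', ← b]
    obtain ⟨w, hw, hw'⟩ := S.surO ψ' _ (h.mem 0) g' (ψ (c (n - 1)))
    by_cases hwc : ∃ i, w = c i
    · obtain ⟨i, rfl⟩ := hwc
      rcases hu i hw with e | e
      · rw [← hw', e]
      · rw [e, b'] at hw'
        exact absurd (S.injO ψ _ (h.mem 0) g h1 h2 hw') hab
    · push Not at hwc
      rw [e2' w hwc, ← e2 w hwc] at hw'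
      exact absurd (S.injO ψ _ (h.mem 0) g hw h2 hw') (hwc _)
  by_contra hodd
  rw [Nat.not_odd_iff_even] at hodd
  obtain ⟨r, hr⟩ := hodd
  have ev : ∀ s, φ (c (1 + (2 * s) % (n - 1))) = φ (c 1) := by
    intro s
    induction s with
    | zero => simp
    | succ s ih => rw [show 2 * (s + 1) = 2 * s + 2 by ring, step, ih]
  have := ev (r - 1)
  rw [show 2 * (r - 1) = n - 2 by omega, hm1, show 1 + (n - 2) = n - 1 by omega] at this
  exact hab (S.injO φ _ (h.mem 0) hφ h2 h1 this).symm

def Chordless (O I : ℕ → Set ℕ) (c : ℕ → ℕ) (n : ℕ) : Prop :=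
  ∀ i j, (c j ∈ O (c i) ∨ c j ∈ I (c i)) → (i + 1) % n = j % n ∨ (j + 1) % n = i % n

theorem Chordless.nb {c : ℕ → ℕ} {n : ℕ} (h : Cyc L O I c n) (hc : Chordless O I c n) (i j : ℕ)
    (hij : c j ∈ O (c (i + 1)) ∨ c j ∈ I (c (i + 1))) : c j = c (i + 2) ∨ c j = c i := by
  rcases hc _ _ hij with e | e
  · left; rw [h.inj]; exact e.symm
  · right; rw [h.inj]; exact Nat.ModEq.add_right_cancel' 1 e

/-- passing vertex without chords forces out- and in-degrees at most one in the cycle -/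
theorem passK (S : Sys k L O I G) {c : ℕ → ℕ} {n : ℕ} (h : Cyc L O I c n) (t : ℕ)
    (hnb : ∀ j, c j ∈ O (c (t + 1)) ∨ c j ∈ I (c (t + 1)) → c j = c (t + 2) ∨ c j = c t)
    (hO : ¬ (c t ∈ O (c (t + 1)) ∧ c (t + 2) ∈ O (c (t + 1))))
    (hI : ¬ (c t ∈ I (c (t + 1)) ∧ c (t + 2) ∈ I (c (t + 1)))) (i j l : ℕ) :
    (c j ∈ O (c i) → c l ∈ O (c i) → c j = c l) ∧
    (c j ∈ I (c i) → c l ∈ I (c i) → c j = c l) := by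
  have h3 := h.three
  have hs := h.shift (t + 1)
  obtain ⟨i', hi'⟩ : ∃ i', c i = c (i' + (t + 1)) := by
    refine ⟨i + (t + 1) * (n - 1), ?_⟩
    have : i + (t + 1) * (n - 1) + (t + 1) = i + (t + 1) * n := by
      obtain ⟨m, rfl⟩ : ∃ m, n = m + 1 := ⟨n - 1, by omega⟩
      simp; ring
    rw [this, h.inj]; simp
  have fix : ∀ j, ∃ j', c j = c (j' + (t + 1)) := by
    intro j
    refine ⟨j + (t + 1) * (n - 1), ?_⟩
    have : j + (t + 1) * (n - 1) + (t + 1) = j + (t + 1) * n := by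
      obtain ⟨m, rfl⟩ : ∃ m, n = m + 1 := ⟨n - 1, by omega⟩
      simp; ring
    rw [this, h.inj]; simp
  obtain ⟨j', hj'⟩ := fix j
  obtain ⟨l', hl'⟩ := fix l
  rw [hi', hj', hl']
  have e12 : 1 + (t + 1) = t + 2 := by ring
  rcases h.adj (t + 1) with ha | ha
  · refine keyK' S hs (by simpa [e12] using ha) ?_ i' j' l'
    intro s hsO
    simp only [zero_add, e12] at hsO ⊢
    rcases hnb _ (Or.inl hsO) with e | e
    · exact e
    · exact absurd ⟨e ▸ hsO, ha⟩ hO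
  · refine (keyK' S.swap hs.swap (by simpa [e12] using ha) ?_ i' j' l').symm
    intro s hsO
    simp only [zero_add, e12] at hsO ⊢
    rcases hnb _ (Or.inr hsO) with e | e
    · exact e
    · exact absurd ⟨e ▸ hsO, ha⟩ hI

theorem dirO (S : Sys k L O I G) {c : ℕ → ℕ} {n : ℕ} (h : Cyc L O I c n)
    (hc : Chordless O I c n) (t : ℕ) (ht : c t ∈ O (c (t + 1)))
    (ht2 : c (t + 2) ∈ O (c (t + 1))) : False := by
  have h3 := h.three
  have hne : ∀ t, c t ≠ c (t + 2) := fun t e => by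
    rw [h.inj] at e
    have : 0 % n = 2 % n := Nat.ModEq.add_left_cancel' t (show t + 0 ≡ t + 2 [MOD n] from e)
    rw [Nat.mod_eq_of_lt (by omega : 2 < n)] at this
    simp at this
  have hodd : Odd n := by
    have hs := h.shift (t + 1)
    have e1 : n - 1 + (t + 1) = t + n := by omega
    have e2 : 1 + (t + 1) = t + 2 := by ring
    refine par S hs (by simpa [e2] using ht2) ?_ ?_
    · simp only [e1, h.per, zero_add]; exact ht
    · intro i hi
      simp only [e1, h.per, e2, zero_add] at hi ⊢
      exact hc.nb h t _ (Or.inl hi)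
  have hnp : ∀ i, (c i ∈ O (c (i + 1)) ∧ c (i + 2) ∈ O (c (i + 1))) ∨
      (c i ∈ I (c (i + 1)) ∧ c (i + 2) ∈ I (c (i + 1))) := by
    intro i
    by_contra hcon
    push Not at hcon
    have := (passK S h i (fun j => hc.nb h i j) (fun a => hcon.1 a.1 a.2)
      (fun a => hcon.2 a.1 a.2) (t + 1) t (t + 2)).1 ht ht2
    exact hne t this
  have alt : ∀ i, c (i + 2) ∈ O (c (i + 1)) ↔ ¬ c (i + 1) ∈ O (c i) := by
    intro i
    have hsym := S.sym (c (i + 1)) (c i)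
    have d1 := S.dis (c i) (c (i + 1))
    have d2 := S.dis (c (i + 2)) (c (i + 1))
    have := hnp i
    tauto
  have alt2 : ∀ s, (c (2 * s + 1) ∈ O (c (2 * s)) ↔ c 1 ∈ O (c 0)) := by
    intro s
    induction s with
    | zero => simp
    | succ s ih =>
      rw [← ih]
      have a := alt (2 * s)
      have b := alt (2 * s + 1)
      rw [show 2 * s + 1 + 2 = 2 * (s + 1) + 1 by ring,
        show 2 * s + 1 + 1 = 2 * (s + 1) by ring] at b
      rw [show 2 * s + 2 = 2 * (s + 1) by ring] at a
      tauto
  obtain ⟨r, hr⟩ := hodd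
  have a := alt2 r
  have b := alt (2 * r)
  rw [show 2 * r + 2 = 1 + n by omega, ← hr, h.per, h.per0] at b
  rw [← hr, h.per0] at a
  tauto

theorem dirI (S : Sys k L O I G) {c : ℕ → ℕ} {n : ℕ} (h : Cyc L O I c n)
    (hc : Chordless O I c n) (t : ℕ) (ht : c t ∈ I (c (t + 1)))
    (ht2 : c (t + 2) ∈ I (c (t + 1))) : False :=
  dirO S.swap h.swap (fun i j hij => hc i j hij.symm) t ht ht2

theorem nonpass (S : Sys k L O I G) {c : ℕ → ℕ} {n : ℕ} (h : Cyc L O I c n)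
    (ih : ∀ m < n, ∀ c, Cyc L O I c m → Chordless O I c m) (j : ℕ) (hj : 2 ≤ j) (hj' : j + 2 ≤ n)
    (hadj : c j ∈ O (c 0) ∨ c j ∈ I (c 0)) :
    ((c 1 ∈ O (c 0) ∧ c (n - 1) ∈ O (c 0)) ∨ (c 1 ∈ I (c 0) ∧ c (n - 1) ∈ I (c 0))) ∧
    ¬ (c 0 ∈ O (c 1) ∧ c 2 ∈ O (c 1)) ∧ ¬ (c 0 ∈ I (c 1) ∧ c 2 ∈ I (c 1)) := by
  have hadj' : c 0 ∈ O (c j) ∨ c 0 ∈ I (c j) := S.asym hadj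
  have c1 := h.sub 0 j (by omega) (by omega) hadj'
  have c2 := h.sub j n (by omega) (by omega) (by rw [h.per0]; exact hadj)
  have k1 := ih _ (by omega) _ c1
  have k2 := ih _ (by omega) _ c2
  have p1O := dirO S c1 k1 0
  have p1I := dirI S c1 k1 0
  have q1O := dirO S c1 k1 j
  have q1I := dirI S c1 k1 j
  have q2O := dirO S c2 k2 (n - j - 1)
  have q2I := dirI S c2 k2 (n - j - 1)
  have m1 : 1 % (j + 1) = 1 := Nat.mod_eq_of_lt (by omega)
  have m2 : 2 % (j + 1) = 2 := Nat.mod_eq_of_lt (by omega)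
  have m3 : j % (j + 1) = j := Nat.mod_eq_of_lt (by omega)
  have m4 : (j + 2) % (j + 1) = 1 := by
    rw [show j + 2 = 1 + (j + 1) by ring, Nat.add_mod_right, m1]
  have m5 : (n - j - 1) % (n - j + 1) = n - j - 1 := Nat.mod_eq_of_lt (by omega)
  have m6 : (n - j - 1 + 1) % (n - j + 1) = n - j := by
    rw [Nat.mod_eq_of_lt (by omega)]; omega
  have m7 : (n - j - 1 + 2) % (n - j + 1) = 0 := by
    rw [show n - j - 1 + 2 = n - j + 1 by omega, Nat.mod_self]
  simp only [Nat.sub_zero, Nat.zero_add, Nat.zero_mod, m1, m2, m3, m4, Nat.mod_self] at p1O p1I q1O q1I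
  simp only [m5, m6, m7, show j + (n - j - 1) = n - 1 by omega, show j + (n - j) = n by omega,
    h.per0, Nat.add_zero] at q2O q2I
  have a1 := h.adj 0
  have a2 := h.adj (n - 1)
  rw [show n - 1 + 1 = n by omega, h.per0] at a2
  have s1 := S.sym (c 0) (c (n - 1))
  have s2 := S.sym (c (n - 1)) (c 0)
  simp only [Nat.zero_add] at a1
  refine ⟨?_, fun a => p1O a.1 a.2, fun a => p1I a.1 a.2⟩
  clear p1O p1I k1 k2 c1 c2 ih hadj'
  have a2' := S.asym a2
  rcases hadj with hadj | hadj
  · right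
    exact ⟨a1.resolve_left (fun a => q1O hadj a), a2'.resolve_left (fun a => q2O a hadj)⟩
  · left
    exact ⟨a1.resolve_right (fun a => q1I hadj a), a2'.resolve_right (fun a => q2I a hadj)⟩

theorem noChord (S : Sys k L O I G) (n : ℕ) :
    ∀ c, Cyc L O I c n → Chordless O I c n := by
  induction n using Nat.strong_induction_on with
  | _ n ih =>
  intro c h
  have h3 := h.three
  have main : ∀ c, Cyc L O I c n → ∀ j, 2 ≤ j → j + 2 ≤ n → 
      ¬ (c j ∈ O (c 0) ∨ c j ∈ I (c 0)) := by
    intro c h j hj hj' hadj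
    obtain ⟨h1, h2, h4⟩ := nonpass S h ih j hj hj' hadj
    have hne : c 1 ≠ c (n - 1) := fun e => by
      have := h.lt_inj (by omega) (by omega) e; omega
    have hnb : ∀ j, c j ∈ O (c (0 + 1)) ∨ c j ∈ I (c (0 + 1)) → c j = c (0 + 2) ∨ c j = c 0 := by
      intro b hb
      by_contra hcon
      push Not at hcon
      simp only [Nat.zero_add] at hb hcon
      rw [← h.red b] at hb hcon
      have hlt := Nat.mod_lt b (show n > 0 by omega)
      generalize b % n = b at *
      have b0 : b ≠ 0 := fun e => hcon.2 (by rw [e])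
      have b1 : b ≠ 1 := fun e => by
        subst e
        have s := S.sym (c 1) (c 1)
        have d := S.dis (c 1) (c 1)
        tauto
      have b2 : b ≠ 2 := fun e => hcon.1 (by rw [e])
      have hs := h.shift 1
      have := (nonpass S hs ih (b - 1) (by omega) (by omega) (by
        simp only [show b - 1 + 1 = b by omega]; exact hb)).1
      simp only [show n - 1 + 1 = n by omega, h.per0, Nat.zero_add] at this
      tauto
    have := passK S h 0 hnb h2 h4 0 1 (n - 1)
    tauto
  intro i j hij
  by_contra hcon
  push Not at hcon
  have hlt := Nat.mod_lt (j + (n - i % n)) (show n > 0 by omega)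
  have hil := Nat.mod_lt i (show n > 0 by omega)
  have hs := h.shift i
  set d := (j + (n - i % n)) % n with hd
  have hdi : (d + i) % n = j % n := by
    have e : (j + (n - i % n) + i) = j + n + n * (i / n) := by
      have := Nat.mod_add_div i n
      omega
    rw [hd, Nat.mod_add_mod, e]; simp
  have hcd : c (d + i) = c j := (h.inj _ _).2 hdi
  have d0 : d ≠ 0 := fun e => by
    rw [e] at hcd
    rw [← hcd] at hij
    simp only [Nat.zero_add] at hij
    have s := S.sym (c i) (c i)
    have d := S.dis (c i) (c i)
    tauto
  have d1 : d ≠ 1 := fun e => hcon.1 (by rw [← hdi, e, add_comm])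
  have dn : d ≠ n - 1 := fun e => hcon.2 (by
    rw [← Nat.mod_add_mod, ← hdi, Nat.mod_add_mod, e, show n - 1 + i + 1 = i + n by omega]; simp)
  refine main _ hs d (by omega) (by omega) ?_
  simp only [Nat.zero_add, hcd]
  exact hij

open Classical in
theorem degen (S : Sys k L O I G) (T : Finset ℕ) (hT : T.Nonempty) (hTL : ∀ x ∈ T, x ∈ L) :
    ∃ v ∈ T, (T.filter (fun u => u ∈ O v ∨ u ∈ I v)).card ≤ 2 := by
  by_contra hcon
  push Not at hcon
  let P : ℕ → Prop := fun m => ∃ p : ℕ → ℕ, (∀ i ≤ m, ∀ j ≤ m, p i = p j → i = j) ∧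
    (∀ i ≤ m, p i ∈ T) ∧ ∀ i < m, p (i + 1) ∈ O (p i) ∨ p (i + 1) ∈ I (p i)
  have hb : ∀ m, P m → m ≤ T.card := by
    rintro m ⟨p, h1, h2, -⟩
    have : (Finset.range (m + 1)).card ≤ T.card := by
      apply Finset.card_le_card_of_injOn p
      · intro i hi; exact h2 i (by simpa [Nat.lt_succ_iff] using hi)
      · intro i hi j hj e
        exact h1 i (by simpa [Nat.lt_succ_iff] using hi) j (by simpa [Nat.lt_succ_iff] using hj) e
    simp at this; omega
  have h0 : P 0 := by
    obtain ⟨x, hx⟩ := hT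
    exact ⟨fun _ => x, fun i hi j hj _ => by omega, fun _ _ => hx, fun i hi => by omega⟩
  have hPm : P (Nat.findGreatest P T.card) := Nat.findGreatest_spec (Nat.zero_le _) h0
  have hmax : ∀ m, P m → m ≤ Nat.findGreatest P T.card := fun m hm => Nat.le_findGreatest (hb m hm) hm
  generalize Nat.findGreatest P T.card = m at hPm hmax
  obtain ⟨p, h1, h2, h3⟩ := hPm
  have hnb : ∀ u ∈ T, (u ∈ O (p 0) ∨ u ∈ I (p 0)) → ∃ i ≤ m, p i = u := by
    intro u hu hadj
    by_contra hno
    push Not at hno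
    have : P (m + 1) := by
      refine ⟨fun i => if i = 0 then u else p (i - 1), ?_, ?_, ?_⟩
      · intro i hi j hj e
        by_cases hi0 : i = 0 <;> by_cases hj0 : j = 0 <;> simp only [hi0, hj0, if_true, if_false] at e ⊢
        · exact absurd e.symm (hno _ (by omega))
        · exact absurd e (hno _ (by omega))
        · have := h1 _ (by omega) _ (by omega) e; omega
      · intro i hi
        by_cases hi0 : i = 0
        · simpa [hi0] using hu
        · simp only [hi0, if_false]; exact h2 _ (by omega)
      · intro i hi
        by_cases hi0 : i = 0
        · subst hi0
          simp only [if_true, Nat.zero_add, one_ne_zero, if_false, Nat.sub_self]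
          exact S.asym hadj
        · have := h3 (i - 1) (by omega)
          rw [show i - 1 + 1 = i by omega] at this
          simpa [hi0] using this
    have := hmax _ this
    omega
  let Q := (Finset.range (m + 1)).filter (fun i => p i ∈ O (p 0) ∨ p i ∈ I (p 0))
  have hQ : 3 ≤ Q.card := by
    have hc := hcon (p 0) (h2 0 (by omega))
    have : (T.filter (fun u => u ∈ O (p 0) ∨ u ∈ I (p 0))) ⊆ Q.image p := by
      intro u hu
      rw [Finset.mem_filter] at hu
      obtain ⟨i, hi, e⟩ := hnb u hu.1 hu.2
      rw [Finset.mem_image]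
      refine ⟨i, ?_, e⟩
      rw [Finset.mem_filter, Finset.mem_range, e]
      exact ⟨by omega, hu.2⟩
    have a := Finset.card_le_card this
    have b := Finset.card_image_le (s := Q) (f := p)
    omega
  have hQne : Q.Nonempty := Finset.card_pos.1 (by omega)
  set s := Q.max' hQne with hs
  have hsQ : s ∈ Q := Q.max'_mem hQne
  obtain ⟨j, hj⟩ : ((Q.erase s).erase 1).Nonempty := by
    apply Finset.card_pos.1
    have a := Finset.pred_card_le_card_erase (s := Q) (a := s)
    have b := Finset.pred_card_le_card_erase (s := Q.erase s) (a := 1)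
    omega
  simp only [Finset.mem_erase] at hj
  obtain ⟨hj1, hjs, hjQ⟩ := hj
  have hjle : j ≤ s := Q.le_max' j hjQ
  rw [Finset.mem_filter, Finset.mem_range] at hsQ hjQ
  have hj0 : j ≠ 0 := fun e => by
    subst e
    have s := S.sym (p 0) (p 0)
    have d := S.dis (p 0) (p 0)
    tauto
  have hcyc : Cyc L O I (fun i => p (i % (s + 1))) (s + 1) := by
    refine ⟨by omega, ?_, ?_, ?_⟩
    · intro i i'
      have a := Nat.mod_lt i (show s + 1 > 0 by omega)
      have b := Nat.mod_lt i' (show s + 1 > 0 by omega)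
      exact ⟨fun e => h1 _ (by omega) _ (by omega) e, fun e => by simp only [e]⟩
    · intro i
      have a := Nat.mod_lt i (show s + 1 > 0 by omega)
      exact hTL _ (h2 _ (by omega))
    · intro i
      have a := Nat.mod_lt i (show s + 1 > 0 by omega)
      by_cases hi : i % (s + 1) = s
      · have : (i + 1) % (s + 1) = 0 := by
          rw [Nat.add_mod, hi, Nat.mod_eq_of_lt (show 1 < s + 1 by omega), Nat.mod_self]
        simp only [hi, this]
        exact S.asym hsQ.2
      · have : (i + 1) % (s + 1) = i % (s + 1) + 1 := by
          rw [Nat.add_mod, Nat.mod_eq_of_lt (show 1 < s + 1 by omega), Nat.mod_eq_of_lt]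
          omega
        simp only [this]
        exact h3 _ (by omega)
  have mj : j % (s + 1) = j := Nat.mod_eq_of_lt (by omega)
  have := noChord S _ _ hcyc 0 j (by simpa [mj] using hjQ.2)
  rw [mj, Nat.mod_eq_of_lt (by omega), Nat.mod_eq_of_lt (by omega)] at this
  simp at this
  omega

end GB
namespace GB

theorem mono_tg {r p : ℕ → ℕ → Prop} {a b : ℕ} (h : Relation.TransGen r a b)
    (hrp : ∀ a b, r a b → p a b) : Relation.TransGen p a b := by
  induction h with
  | single h => exact .single (hrp _ _ h)
  | tail _ h ih => exact .tail ih (hrp _ _ h)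

theorem ext_aux (R : ℕ → ℕ → Prop) {k : ℕ} (φ : ℕ → Fin k) (v : ℕ) (c : Fin k)
    (hv : ¬ R v v) (hR : ∀ u, R v u → φ u ≠ c)
    (hg : ∀ x, ¬ Relation.TransGen (fun x y => (R x y ∧ x ≠ v ∧ y ≠ v) ∧ φ x = φ y) x x) :
    ∀ x, ¬ Relation.TransGen
      (fun x y => R x y ∧ Function.update φ v c x = Function.update φ v c y) x x := by
  have hsink : ∀ y, ¬ (R v y ∧ Function.update φ v c v = Function.update φ v c y) := by
    rintro y ⟨h1, h2⟩
    have : y ≠ v := fun e => hv (e ▸ h1)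
    rw [Function.update_self, Function.update_of_ne this] at h2
    exact hR y h1 h2.symm
  have key : ∀ x y, Relation.TransGen
      (fun x y => R x y ∧ Function.update φ v c x = Function.update φ v c y) x y → y ≠ v →
      Relation.TransGen (fun x y => (R x y ∧ x ≠ v ∧ y ≠ v) ∧ φ x = φ y) x y := by
    intro x y h
    induction h with
    | single h =>
      intro hy
      have hx : x ≠ v := fun e => hsink _ (e ▸ h)
      refine .single ⟨⟨h.1, hx, hy⟩, ?_⟩
      have := h.2
      rwa [Function.update_of_ne hx, Function.update_of_ne hy] at this
    | @tail b y _ h ih =>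
      intro hy
      have hx : b ≠ v := fun e => hsink _ (e ▸ h)
      refine .tail (ih hx) ⟨⟨h.1, hx, hy⟩, ?_⟩
      have := h.2
      rwa [Function.update_of_ne hx, Function.update_of_ne hy] at this
  intro x hx
  refine hg x (key x x hx ?_)
  rintro rfl
  obtain ⟨b, hb, -⟩ := Relation.TransGen.head'_iff.1 hx
  exact hsink _ hb

theorem ext_aux' (R : ℕ → ℕ → Prop) {k : ℕ} (φ : ℕ → Fin k) (v : ℕ) (c : Fin k)
    (hv : ¬ R v v) (hR : ∀ u, R u v → φ u ≠ c)
    (hg : ∀ x, ¬ Relation.TransGen (fun x y => (R x y ∧ x ≠ v ∧ y ≠ v) ∧ φ x = φ y) x x) :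
    ∀ x, ¬ Relation.TransGen
      (fun x y => R x y ∧ Function.update φ v c x = Function.update φ v c y) x x := by
  intro x hx
  refine ext_aux (fun x y => R y x) φ v c hv hR ?_ x ?_
  · intro x hx
    refine hg x (Relation.transGen_swap.1 (mono_tg hx ?_))
    rintro a b ⟨⟨h1, h2, h3⟩, h4⟩
    exact ⟨⟨h1, h3, h2⟩, h4.symm⟩
  · refine Relation.transGen_swap.1 (mono_tg hx ?_)
    rintro a b ⟨h1, h4⟩
    exact ⟨h1, h4.symm⟩

def Gd (D : Digr) (k : ℕ) (φ : ℕ → Fin k) (v : ℕ) : Prop :=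
  ∀ x, ¬ Relation.TransGen (fun x y => ((x, y) ∈ D.arcs ∧ x ≠ v ∧ y ≠ v) ∧ φ x = φ y) x x

theorem colorable_big (D : Digr) : ∃ n, D.Colorable n := by
  refine ⟨D.verts.sup id + 1, fun x => Fin.ofNat _ x, ?_⟩
  have hlt : ∀ x ∈ D.verts, x < D.verts.sup id + 1 := fun x hx =>
    Nat.lt_succ_of_le (Finset.le_sup (f := id) hx)
  intro v hv
  obtain ⟨b, ⟨h1, h2⟩, -⟩ := Relation.TransGen.head'_iff.1 hv
  have := D.arcs_sub _ h1
  apply D.no_loops _ h1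
  have e := congrArg Fin.val h2
  simpa [Fin.ofNat, Nat.mod_eq_of_lt (hlt _ this.1), Nat.mod_eq_of_lt (hlt _ this.2)] using e

theorem Colorable.mono {D : Digr} {m n : ℕ} (h : D.Colorable m) (hmn : m ≤ n) : D.Colorable n := by
  obtain ⟨φ, hφ⟩ := h
  refine ⟨fun x => Fin.castLE hmn (φ x), fun v hv => hφ v (mono_tg hv ?_)⟩
  rintro a b ⟨h1, h2⟩
  exact ⟨h1, Fin.castLE_injective hmn h2⟩

theorem not_col {k : ℕ} {D : Digr} (hD : D.Critical (k + 1)) : ¬ D.Colorable k := fun h => by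
  have : D.dichrom ≤ k := Nat.sInf_le h
  rw [hD.1] at this; omega

theorem exG {k : ℕ} {D : Digr} (hD : D.Critical (k + 1)) (v : ℕ) (hv : v ∈ D.verts) : ∃ φ, Gd D k φ v := by
  have h1 : (D.delete v).dichrom < k + 1 := by
    apply hD.2
    · exact ⟨Finset.erase_subset _ _, Finset.filter_subset _ _⟩
    · intro e
      have : v ∈ (D.delete v).verts := by rw [e]; exact hv
      simp [Digr.delete] at this
  have h2 : (D.delete v).Colorable (D.delete v).dichrom := Nat.sInf_mem (colorable_big _)
  obtain ⟨φ, hφ⟩ := Colorable.mono h2 (Nat.lt_succ_iff.1 h1)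
  refine ⟨φ, fun x hx => hφ x (mono_tg hx ?_)⟩
  rintro a b ⟨h1, h2⟩
  exact ⟨by simpa [Digr.delete] using h1, h2⟩

theorem surO {k : ℕ} {D : Digr} (hD : D.Critical (k + 1)) (φ : ℕ → Fin k) (v : ℕ) (h : Gd D k φ v) (c : Fin k) :
    ∃ w ∈ D.outNbrs v, φ w = c := by
  by_contra hcon
  push Not at hcon
  refine not_col hD ⟨_, ext_aux (fun x y => (x, y) ∈ D.arcs) φ v c (fun e => D.no_loops _ e rfl) ?_ h⟩
  intro u hu
  exact hcon u (by simpa [Digr.outNbrs, hu] using (D.arcs_sub _ hu).2)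

theorem surI {k : ℕ} {D : Digr} (hD : D.Critical (k + 1)) (φ : ℕ → Fin k) (v : ℕ) (h : Gd D k φ v) (c : Fin k) :
    ∃ w ∈ D.inNbrs v, φ w = c := by
  by_contra hcon
  push Not at hcon
  refine not_col hD ⟨_, ext_aux' (fun x y => (x, y) ∈ D.arcs) φ v c (fun e => D.no_loops _ e rfl) ?_ h⟩
  intro u hu
  exact hcon u (by simpa [Digr.inNbrs, hu] using (D.arcs_sub _ hu).1)

theorem degO {k : ℕ} {D : Digr} (hD : D.Critical (k + 1)) (v : ℕ) (hv : v ∈ D.verts) : k ≤ D.outDeg v := by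
  obtain ⟨φ, h⟩ := exG hD v hv
  have : (Finset.univ : Finset (Fin k)) ⊆ (D.outNbrs v).image φ := fun c _ => by
    simpa using surO hD φ v h c
  have := (Finset.card_le_card this).trans Finset.card_image_le
  simpa [Digr.outDeg] using this

theorem degI {k : ℕ} {D : Digr} (hD : D.Critical (k + 1)) (v : ℕ) (hv : v ∈ D.verts) : k ≤ D.inDeg v := by
  obtain ⟨φ, h⟩ := exG hD v hv
  have : (Finset.univ : Finset (Fin k)) ⊆ (D.inNbrs v).image φ := fun c _ => by
    simpa using surI hD φ v h c
  have := (Finset.card_le_card this).trans Finset.card_image_le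
  simpa [Digr.inDeg] using this

theorem sys {k : ℕ} {D : Digr} (hD : D.Critical (k + 1)) (hdigon : ∀ x y : ℕ, (x, y) ∈ D.arcs → (y, x) ∉ D.arcs) :
    Sys k (D.lowVerts (k + 1)) (fun v => D.outNbrs v) (fun v => D.inNbrs v) (Gd D k) := by
  have low : ∀ v ∈ (D.lowVerts (k + 1) : Set ℕ), v ∈ D.verts ∧ (D.outNbrs v).card = k ∧
      (D.inNbrs v).card = k := by
    intro v hv
    simpa [Digr.lowVerts, Digr.outDeg, Digr.inDeg] using hv
  have mO : ∀ u v, u ∈ D.outNbrs v ↔ (v, u) ∈ D.arcs := by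
    intro u v
    simp only [Digr.outNbrs, Finset.mem_filter, and_iff_right_iff_imp]
    exact fun h => (D.arcs_sub _ h).2
  have mI : ∀ u v, u ∈ D.inNbrs v ↔ (u, v) ∈ D.arcs := by
    intro u v
    simp only [Digr.inNbrs, Finset.mem_filter, and_iff_right_iff_imp]
    exact fun h => (D.arcs_sub _ h).1
  have injO : ∀ φ, ∀ v ∈ (D.lowVerts (k + 1) : Set ℕ), Gd D k φ v →
      Set.InjOn φ (D.outNbrs v : Set ℕ) := by
    intro φ v hv h
    apply Finset.injOn_of_card_image_eq
    have : (D.outNbrs v).image φ = Finset.univ := by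
      ext c; simpa using surO hD φ v h c
    rw [this, (low v hv).2.1]; simp
  have injI : ∀ φ, ∀ v ∈ (D.lowVerts (k + 1) : Set ℕ), Gd D k φ v →
      Set.InjOn φ (D.inNbrs v : Set ℕ) := by
    intro φ v hv h
    apply Finset.injOn_of_card_image_eq
    have : (D.inNbrs v).image φ = Finset.univ := by
      ext c; simpa using surI hD φ v h c
    rw [this, (low v hv).2.2]; simp
  refine ⟨fun v hv => exG hD v (low v hv).1, injO, injI, fun φ v _ h c => surO hD φ v h c,
    fun φ v _ h c => surI hD φ v h c, ?_, ?_, ?_, ?_⟩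
  · intro φ v hv h u hu
    refine ext_aux (fun x y => (x, y) ∈ D.arcs ∧ x ≠ u ∧ y ≠ u) φ v (φ u)
      (fun e => D.no_loops _ e.1 rfl) ?_ ?_
    · rintro w ⟨h1, h2, h3⟩ e
      exact h3 (injO φ v hv h (by simpa [mO] using h1) hu e)
    · intro x hx
      refine h x (mono_tg hx ?_)
      rintro a b ⟨⟨h1, h2⟩, h3⟩
      exact ⟨⟨h1.1, h2⟩, h3⟩
  · intro φ v hv h u hu
    refine ext_aux' (fun x y => (x, y) ∈ D.arcs ∧ x ≠ u ∧ y ≠ u) φ v (φ u)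
      (fun e => D.no_loops _ e.1 rfl) ?_ ?_
    · rintro w ⟨h1, h2, h3⟩ e
      exact h2 (injI φ v hv h (by simpa [mI] using h1) hu e)
    · intro x hx
      refine h x (mono_tg hx ?_)
      rintro a b ⟨⟨h1, h2⟩, h3⟩
      exact ⟨⟨h1.1, h2⟩, h3⟩
  · intro u v
    simp only [Finset.mem_coe, mO, mI]
  · intro u v h h'
    simp only [Finset.mem_coe, mO, mI] at h h'
    exact hdigon _ _ h h'

theorem arcs_low {k : ℕ} {D : Digr} (hD : D.Critical (k + 1)) (hdigon : ∀ x y : ℕ, (x, y) ∈ D.arcs → (y, x) ∉ D.arcs) (n : ℕ) :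
    ∀ T : Finset ℕ, T.card = n → T ⊆ D.lowVerts (k + 1) →
      (D.arcs.filter (fun a => a.1 ∈ T ∧ a.2 ∈ T)).card ≤ 2 * n := by
  classical
  induction n with
  | zero =>
    intro T hT _
    rw [Finset.card_eq_zero] at hT
    simp [hT]
  | succ n ih =>
    intro T hT hTL
    obtain ⟨v, hv, hdeg⟩ := degen (sys hD hdigon) T (Finset.card_pos.1 (by omega))
      (fun x hx => hTL hx)
    have h1 := ih (T.erase v) (by rw [Finset.card_erase_of_mem hv]; omega)
      ((Finset.erase_subset _ _).trans hTL)
    have h2 : D.arcs.filter (fun a => a.1 ∈ T ∧ a.2 ∈ T) ⊆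
        D.arcs.filter (fun a => a.1 ∈ T.erase v ∧ a.2 ∈ T.erase v) ∪
        D.arcs.filter (fun a => (a.1 = v ∧ a.2 ∈ T) ∨ (a.2 = v ∧ a.1 ∈ T)) := by
      rintro ⟨a, b⟩ h
      simp only [Finset.mem_filter, Finset.mem_union, Finset.mem_erase] at h ⊢
      tauto
    have h3 : (D.arcs.filter (fun a => (a.1 = v ∧ a.2 ∈ T) ∨ (a.2 = v ∧ a.1 ∈ T))).card ≤
        (T.filter (fun u => u ∈ (D.outNbrs v : Set ℕ) ∨ u ∈ (D.inNbrs v : Set ℕ))).card := by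
      apply Finset.card_le_card_of_injOn (fun a => if a.1 = v then a.2 else a.1)
      · rintro ⟨a, b⟩ h
        simp only [Finset.coe_filter, Set.mem_ofPred_eq] at h
        obtain ⟨hab, ⟨rfl, hb⟩ | ⟨rfl, ha⟩⟩ := h
        · simp [Digr.outNbrs, hab, hb, (D.arcs_sub _ hab).2]
        · have := D.no_loops _ hab
          simp only at this
          simp [Digr.inNbrs, hab, ha, (D.arcs_sub _ hab).1, this]
      · rintro ⟨a, b⟩ h ⟨a', b'⟩ h' e
        simp only [Finset.coe_filter, Set.mem_ofPred_eq] at h h'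
        have l := D.no_loops _ h.1
        have l' := D.no_loops _ h'.1
        have d := hdigon _ _ h.1
        have d' := hdigon _ _ h'.1
        simp only at l l' d d' e
        obtain ⟨hab, ⟨rfl, hb⟩ | ⟨rfl, ha⟩⟩ := h <;> obtain ⟨hab', ⟨rfl, hb'⟩ | ⟨rfl, ha'⟩⟩ := h'
        · simp_all
        · simp_all
        · simp_all
        · simp_all
    have h4 := (Finset.card_le_card h2).trans (Finset.card_union_le _ _)
    have h5 : (T.filter (fun u => u ∈ (D.outNbrs v : Set ℕ) ∨ u ∈ (D.inNbrs v : Set ℕ))).card ≤ 2 := by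
      convert hdeg
    omega

theorem tail_sum (D : Digr) (T : Finset ℕ) :
    (D.arcs.filter (fun a => a.1 ∈ T)).card = ∑ v ∈ T, D.outDeg v := by
  rw [Finset.card_eq_sum_card_fiberwise (f := Prod.fst) (t := T) (by
    intro a ha; simp at ha; exact ha.2)]
  refine Finset.sum_congr rfl fun v hv => ?_
  symm
  apply Finset.card_bij (fun u _ => (v, u))
  · intro u hu
    simp only [Digr.outNbrs, Finset.mem_filter] at hu
    simp [hu.2, hv]
  · intro a _ b _ e; simpa using e
  · rintro ⟨a, b⟩ h
    simp only [Finset.mem_filter] at h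
    obtain ⟨⟨h1, h2⟩, rfl⟩ := h
    exact ⟨b, by simp [Digr.outNbrs, h1, (D.arcs_sub _ h1).2], rfl⟩

theorem head_sum (D : Digr) (T : Finset ℕ) :
    (D.arcs.filter (fun a => a.2 ∈ T)).card = ∑ v ∈ T, D.inDeg v := by
  rw [Finset.card_eq_sum_card_fiberwise (f := Prod.snd) (t := T) (by
    intro a ha; simp at ha; exact ha.2)]
  refine Finset.sum_congr rfl fun v hv => ?_
  symm
  apply Finset.card_bij (fun u _ => (u, v))
  · intro u hu
    simp only [Digr.inNbrs, Finset.mem_filter] at hu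
    simp [hu.2, hv]
  · intro a _ b _ e; simpa using e
  · rintro ⟨b, a⟩ h
    simp only [Finset.mem_filter] at h
    obtain ⟨⟨h1, h2⟩, rfl⟩ := h
    exact ⟨b, by simp [Digr.inNbrs, h1, (D.arcs_sub _ h1).1], rfl⟩

theorem count {k : ℕ} {D : Digr} (hD : D.Critical (k + 1)) (hdigon : ∀ x y : ℕ, (x, y) ∈ D.arcs → (y, x) ∉ D.arcs) :
    ∃ l h : ℕ, D.verts.card = l + h ∧ 2 * k * (l + h) + h ≤ 2 * D.arcs.card ∧
      2 * k * l ≤ D.arcs.card + 2 * l := by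
  set T := D.lowVerts (k + 1) with hT
  have hTV : T ⊆ D.verts := Finset.filter_subset _ _
  refine ⟨T.card, (D.verts \ T).card, ?_, ?_, ?_⟩
  · rw [Finset.card_sdiff_of_subset hTV]
    have := Finset.card_le_card hTV
    omega
  · have e1 : D.arcs.filter (fun a => a.1 ∈ D.verts) = D.arcs :=
      Finset.filter_true_of_mem fun a ha => (D.arcs_sub a ha).1
    have e2 : D.arcs.filter (fun a => a.2 ∈ D.verts) = D.arcs :=
      Finset.filter_true_of_mem fun a ha => (D.arcs_sub a ha).2
    have s1 := tail_sum D D.verts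
    have s2 := head_sum D D.verts
    rw [e1] at s1
    rw [e2] at s2
    have s3 : 2 * D.arcs.card = ∑ v ∈ D.verts, (D.outDeg v + D.inDeg v) := by
      rw [Finset.sum_add_distrib]; omega
    rw [s3, ← Finset.sum_sdiff hTV]
    have a : (D.verts \ T).card * (2 * k + 1) ≤ ∑ v ∈ D.verts \ T, (D.outDeg v + D.inDeg v) := by
      rw [← smul_eq_mul]
      apply Finset.card_nsmul_le_sum
      intro v hv
      rw [Finset.mem_sdiff] at hv
      have o := degO hD v hv.1
      have i := degI hD v hv.1
      have : ¬ (D.outDeg v = k ∧ D.inDeg v = k) := fun e => hv.2 (by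
        simp [hT, Digr.lowVerts, hv.1, e])
      omega
    have b : T.card * (2 * k) ≤ ∑ v ∈ T, (D.outDeg v + D.inDeg v) := by
      rw [← smul_eq_mul]
      apply Finset.card_nsmul_le_sum
      intro v hv
      have o := degO hD v (hTV hv)
      have i := degI hD v (hTV hv)
      omega
    nlinarith
  · have h1 := arcs_low hD hdigon _ T rfl (by rw [hT])
    have s1 := tail_sum D T
    have s2 := head_sum D T
    have e1 : ∑ v ∈ T, D.outDeg v = T.card * k := by
      rw [← smul_eq_mul]
      apply Finset.sum_eq_card_nsmul
      intro v hv
      simp [hT, Digr.lowVerts] at hv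
      exact hv.2.1
    have e2 : ∑ v ∈ T, D.inDeg v = T.card * k := by
      rw [← smul_eq_mul]
      apply Finset.sum_eq_card_nsmul
      intro v hv
      simp [hT, Digr.lowVerts] at hv
      exact hv.2.2
    have u := Finset.card_union_add_card_inter (D.arcs.filter (fun a => a.1 ∈ T))
      (D.arcs.filter (fun a => a.2 ∈ T))
    rw [← Finset.filter_and, ← Finset.filter_or] at u
    have f := Finset.card_filter_le D.arcs (fun a => a.1 ∈ T ∨ a.2 ∈ T)
    nlinarith

end GB

open Digr in
/-- Let `k ≥ 3` and let `D` be a `(k+1)`-critical digraph without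
digons that is not the bidirected complete graph on `k + 1` vertices. Then
`2|A(D)| ≥ (2k + (2k - 2)/((2k + 1)² - 3)) · |V(D)|`. -/
theorem gallai_bound (k : ℕ) (hk : 3 ≤ k) (D : Digr)
    (hD : D.Critical (k + 1))
    (hdigon : ∀ x y : ℕ, (x, y) ∈ D.arcs → (y, x) ∉ D.arcs)
    (hnotK : ¬ (D.verts.card = k + 1 ∧ D.IsBidirComplete)) :
    ((2 * k + (2 * k - 2) / ((2 * k + 1) ^ 2 - 3) : ℚ)) * D.verts.card ≤
      2 * D.arcs.card := by
  obtain ⟨l, h, h1, h2, h3⟩ := GB.count hD hdigon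
  have hk' : (3 : ℚ) ≤ k := by exact_mod_cast hk
  have h2' : (2 * k * (l + h) + h : ℚ) ≤ 2 * D.arcs.card := by exact_mod_cast h2
  have h3' : (2 * k * l : ℚ) ≤ D.arcs.card + 2 * l := by exact_mod_cast h3
  have hl : (0 : ℚ) ≤ l := Nat.cast_nonneg l
  have hh : (0 : ℚ) ≤ h := Nat.cast_nonneg h
  rw [h1]
  push_cast
  have hpos : (0 : ℚ) < (2 * k + 1) ^ 2 - 3 := by nlinarith
  set e : ℚ := (2 * k - 2) / ((2 * k + 1) ^ 2 - 3) with he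
  have he' : e * ((2 * k + 1) ^ 2 - 3) = 2 * k - 2 := by rw [he]; field_simp
  have hepos : 0 < e := by rw [he]; apply div_pos <;> linarith
  have he3 : (4 * k - 3) * e ≤ 2 * k - 4 := by
    rw [he, ← mul_div_assoc, div_le_iff₀ hpos]
    nlinarith [mul_nonneg (sub_nonneg.2 hk') (sub_nonneg.2 hk'), mul_nonneg (mul_nonneg (sub_nonneg.2 hk') (sub_nonneg.2 hk')) (sub_nonneg.2 hk')]
  by_cases hc : e * (l + h) ≤ h
  · linarith [add_mul (2 * (k : ℚ)) e (l + h)]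
  · push Not at hc
    -- h < e (l + h)
    have a : (4 * k - 4 : ℚ) * l ≤ 2 * D.arcs.card := by linarith
    refine le_trans ?_ a
    have b : (2 * k + e + (2 * k - 4 - (4 * k - 3) * e)) * (l + h) ≤ (4 * k - 4 : ℚ) * l := by
      nlinarith [mul_lt_mul_of_pos_left hc (show (0 : ℚ) < 4 * k - 4 by linarith)]
    have c : 0 ≤ (2 * k - 4 - (4 * k - 3) * e) * (l + h) := mul_nonneg (by linarith) (by linarith)
    linarith [add_mul (2 * k + e) (2 * k - 4 - (4 * k - 3) * e) ((l : ℚ) + h)]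
end
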